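/- Let M be a model category with all small limits and colimits and K a simplicial set. Then the category Fun^b(𝐊, M) of bounded diagrams 𝐊 → M, equipped with the following three classes of morphisms, satisfies the axioms MC1–MC5 of a model category: a natural transformation Ψ : F → G is a weak equivalence (respectively a fibration) if Ψ_σ : F(σ) → G(σ) is a weak equivalence (respectively a fibration) in M for every simplex σ of K, and Ψ is a cofibration if for every non-degenerate simplex σ of K the canonical map M_Ψ(σ) → G(σ) is a cofibration in M. -/

import Mathlib

open CategoryTheory CategoryTheory.Limits

universe w v u v₂ u₂ v₃ u₃

/-- A morphism `f` is a retract of a morphism `g` (in the arrow category). -/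
def IsRetractOfArrow {C : Type*} [Category C] {X Y X' Y' : C}
    (f : X ⟶ Y) (g : X' ⟶ Y') : Prop :=
  ∃ (a : X ⟶ X') (a' : X' ⟶ X) (b : Y ⟶ Y') (b' : Y' ⟶ Y),
    a ≫ a' = 𝟙 X ∧ b ≫ b' = 𝟙 Y ∧ a ≫ g = f ≫ b ∧ a' ≫ f = g ≫ b'

/-- A (Quillen) model structure on a category `M`: three distinguished classes of
morphisms (weak equivalences, fibrations and cofibrations) subject to the axioms
MC2–MC5 (two-out-of-three, retract stability, lifting and factorization).
Bicompleteness (MC1) is imposed separately via `HasLimits`/`HasColimits`. -/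
structure ModelStructure (M : Type u) [Category.{v} M] where
  weq : MorphismProperty M
  fib : MorphismProperty M
  cof : MorphismProperty M
  weq_of_isIso : ∀ {X Y : M} (f : X ⟶ Y), IsIso f → weq f
  weq_comp : ∀ {X Y Z : M} (f : X ⟶ Y) (g : Y ⟶ Z), weq f → weq g → weq (f ≫ g)
  weq_of_comp_left : ∀ {X Y Z : M} (f : X ⟶ Y) (g : Y ⟶ Z), weq f → weq (f ≫ g) → weq g
  weq_of_comp_right : ∀ {X Y Z : M} (f : X ⟶ Y) (g : Y ⟶ Z), weq g → weq (f ≫ g) → weq f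
  weq_retract : ∀ {X Y X' Y' : M} {f : X ⟶ Y} {g : X' ⟶ Y'},
    IsRetractOfArrow f g → weq g → weq f
  fib_retract : ∀ {X Y X' Y' : M} {f : X ⟶ Y} {g : X' ⟶ Y'},
    IsRetractOfArrow f g → fib g → fib f
  cof_retract : ∀ {X Y X' Y' : M} {f : X ⟶ Y} {g : X' ⟶ Y'},
    IsRetractOfArrow f g → cof g → cof f
  lifting_cof_acyclicFib : ∀ {A B X Y : M} (i : A ⟶ B) (p : X ⟶ Y),
    cof i → fib p → weq p → HasLiftingProperty i p
  lifting_acyclicCof_fib : ∀ {A B X Y : M} (i : A ⟶ B) (p : X ⟶ Y),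
    cof i → weq i → fib p → HasLiftingProperty i p
  factorization_cof_acyclicFib : ∀ {X Y : M} (f : X ⟶ Y),
    ∃ (Z : M) (i : X ⟶ Z) (p : Z ⟶ Y), cof i ∧ fib p ∧ weq p ∧ i ≫ p = f
  factorization_acyclicCof_fib : ∀ {X Y : M} (f : X ⟶ Y),
    ∃ (Z : M) (i : X ⟶ Z) (p : Z ⟶ Y), cof i ∧ weq i ∧ fib p ∧ i ≫ p = f

variable {M : Type u} [Category.{v} M]

/-- An object is cofibrant if the map from the initial object to it is a cofibration. -/
def ModelStructure.Cofibrant [HasInitial M] (ms : ModelStructure M) (A : M) : Prop :=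
  ms.cof (initial.to A)

/-- An object is fibrant if the map to the terminal object is a fibration. -/
def ModelStructure.Fibrant [HasTerminal M] (ms : ModelStructure M) (X : M) : Prop :=
  ms.fib (terminal.from X)

open Opposite

/-- The simplex category `𝐊` of a simplicial set `K`: objects are the simplices of `K`
and a morphism `σ ⟶ τ` is a map `α : Δ[n] ⟶ Δ[m]` of standard simplices with
`τ ∘ α = σ`.  It is realized as the opposite of the category of elements of `K`. -/
abbrev SimplexCat (K : SSet.{0}) := K.Elementsᵒᵖ

/-- The functor `𝐋 ⥤ 𝐊` between simplex categories induced by a map `f : L ⟶ K` of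
simplicial sets. -/
def simplexMap {L K : SSet.{0}} (f : L ⟶ K) :
    SimplexCat L ⥤ SimplexCat K :=
  (CategoryOfElements.map f).op

/-- A diagram `F : 𝐊 ⥤ C` is *bounded* if it sends every morphism of `𝐊` whose
underlying map in the simplex category `Δ` is surjective (in particular every
degeneracy morphism `s_iσ ⟶ σ`) to an isomorphism. -/
def BoundedDiagram {C : Type u₂} [Category.{v₂} C] {K : SSet.{0}}
    (F : SimplexCat K ⥤ C) : Prop :=
  ∀ {x y : SimplexCat K} (e : x ⟶ y),
    Function.Surjective e.unop.val.unop.toOrderHom → IsIso (F.map e)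

variable {K : SSet.{0}}

/-- A simplex of a simplicial set is degenerate if it is the image of a
lower-dimensional simplex under a surjective map of `Δ`, i.e. of the form `s_i σ'`. -/
def IsDegenerate (x : K.Elements) : Prop :=
  ∃ (m : SimplexCategory) (α : x.1.unop ⟶ m) (τ : K.obj (op m)),
    Function.Surjective α.toOrderHom ∧ m.len < x.1.unop.len ∧ K.map α.op τ = x.2

/-- The simplex category of the standard simplex `Δ[n]` is the over category of `[n]`
in `Δ`; a simplex `x` of `K` of dimension `n` induces a functor from it to `𝐊`,
sending `α : [m] ⟶ [n]` to the simplex `x ∘ α`.  This realizes the restriction of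
diagrams along `Δ[n] --x--> K`. -/
def toK (x : K.Elements) : Over x.1.unop ⥤ SimplexCat K where
  obj g := op (K.elementsMk (op g.left) (K.map g.hom.op x.2))
  map {g g'} w :=
    Quiver.Hom.op
      (CategoryOfElements.homMk (K.elementsMk (op g'.left) (K.map g'.hom.op x.2))
        (K.elementsMk (op g.left) (K.map g.hom.op x.2)) w.left.op (by
          dsimp
          rw [← FunctorToTypes.map_comp_apply, ← op_comp, Over.w w]))
  map_id g := rfl
  map_comp w w' := rfl

/-- The canonical morphism in `𝐊` from a face of the simplex `x` to `x`. -/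
def toVertexHom (x : K.Elements) (g : Over x.1.unop) : (toK x).obj g ⟶ op x :=
  Quiver.Hom.op
    (CategoryOfElements.homMk x (K.elementsMk (op g.left) (K.map g.hom.op x.2))
      g.hom.op rfl)

lemma toVertexHom_natural (x : K.Elements) {g g' : Over x.1.unop} (w : g ⟶ g') :
    (toK x).map w ≫ toVertexHom x g' = toVertexHom x g := by
  apply Quiver.Hom.unop_inj
  apply Subtype.ext
  dsimp [toK, toVertexHom]
  exact congrArg Quiver.Hom.op (Over.w w)

variable {M : Type u} [Category.{v} M] [HasColimits M]

/-- The restriction of a diagram `F : 𝐊 ⥤ M` along `∂Δ[n] ↪ Δ[n] --x--> K`: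
the simplex category of `∂Δ[n]` is the full subcategory of that of `Δ[n]` on the
non-surjective maps `[m] ⟶ [n]`. -/
def bdryRestrict (x : K.Elements) (F : SimplexCat K ⥤ M) :
    ObjectProperty.FullSubcategory (fun g : Over x.1.unop => ¬ Function.Surjective g.hom.toOrderHom) ⥤ M :=
  ObjectProperty.ι _ ⋙ toK x ⋙ F

/-- The canonical cocone on the boundary restriction with vertex `F(x)`. -/
noncomputable def bdryCocone (x : K.Elements) (F : SimplexCat K ⥤ M) :
    Cocone (bdryRestrict x F) where
  pt := F.obj (op x)
  ι :=
    { app := fun b => F.map (toVertexHom x b.obj)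
      naturality := fun b b' w => by
        dsimp [bdryRestrict]
        rw [Category.comp_id, ← F.map_comp, toVertexHom_natural] }

/-- The canonical morphism `colim_{∂𝚫[n]} F ⟶ F(x)` for a simplex `x` of `K`. -/
noncomputable def bdryToVertex (x : K.Elements) (F : SimplexCat K ⥤ M) :
    colimit (bdryRestrict x F) ⟶ F.obj (op x) :=
  colimit.desc _ (bdryCocone x F)

/-- The morphism `colim_{∂𝚫[n]} F ⟶ colim_{∂𝚫[n]} G` induced by `Ψ : F ⟶ G`. -/
noncomputable def bdryMap (x : K.Elements) {F G : SimplexCat K ⥤ M} (Ψ : F ⟶ G) :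
    colimit (bdryRestrict x F) ⟶ colimit (bdryRestrict x G) :=
  colimMap (Functor.whiskerLeft (ObjectProperty.ι _ ⋙ toK x) Ψ)

/-- For `Ψ : F ⟶ G` and a simplex `x`, the canonical map `M_Ψ(x) ⟶ G(x)`, where
`M_Ψ(x)` is the pushout of `F(x) ← colim_{∂𝚫[n]} F → colim_{∂𝚫[n]} G`. -/
noncomputable def latchingComparison (x : K.Elements) {F G : SimplexCat K ⥤ M}
    (Ψ : F ⟶ G) :
    pushout (bdryToVertex x F) (bdryMap x Ψ) ⟶ G.obj (op x) :=
  pushout.desc (Ψ.app (op x)) (bdryToVertex x G) (by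
    apply colimit.hom_ext
    intro b
    let α : bdryRestrict x F ⟶ bdryRestrict x G :=
      Functor.whiskerLeft (ObjectProperty.ι _ ⋙ toK x) Ψ
    have h₁ := ι_colimMap_assoc α b (colimit.desc _ (bdryCocone x G))
    have h₂ := colimit.ι_desc (bdryCocone x G) b
    have h₃ := congrArg (fun t => α.app b ≫ t) h₂
    simp only [bdryToVertex, bdryMap, bdryCocone, colimit.ι_desc_assoc]
    exact (Ψ.naturality (toVertexHom x b.obj)).trans (h₁.trans h₃).symm)

/-- A natural transformation `Ψ : F ⟶ G` between bounded diagrams is a *cofibration*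
if for every non-degenerate simplex `x` of `K` the canonical map `M_Ψ(x) ⟶ G(x)` is a
cofibration in `M`. -/
def IsCofibrationOfDiagrams (ms : ModelStructure M) {F G : SimplexCat K ⥤ M}
    (Ψ : F ⟶ G) : Prop :=
  ∀ x : K.Elements, ¬ IsDegenerate x → ms.cof (latchingComparison x Ψ)

/-- A bounded diagram `F` is *cofibrant* if `∅ ⟶ F` is a cofibration, i.e. if
`colim_{∂𝚫[n]} F ⟶ F(x)` is a cofibration for every non-degenerate simplex `x`. -/
def CofibrantDiagram (ms : ModelStructure M) (F : SimplexCat K ⥤ M) : Prop :=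
  ∀ x : K.Elements, ¬ IsDegenerate x → ms.cof (bdryToVertex x F)

/-- The category `Fun^b(𝐊, M)` of bounded diagrams, as the full subcategory of the
functor category on the bounded diagrams. -/
abbrev BoundedDiagramCat (K : SSet.{0}) (M : Type u) [Category.{v} M] :=
  ObjectProperty.FullSubcategory (fun F : SimplexCat K ⥤ M => BoundedDiagram F)

/-- Objectwise weak equivalences of bounded diagrams. -/
def boundedWeq (ms : ModelStructure M) (K : SSet.{0}) :
    MorphismProperty (BoundedDiagramCat K M) :=
  fun X Y Ψ => ∀ x : SimplexCat K, ms.weq ((Ψ.hom : X.obj ⟶ Y.obj).app x)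

/-- Objectwise fibrations of bounded diagrams. -/
def boundedFib (ms : ModelStructure M) (K : SSet.{0}) :
    MorphismProperty (BoundedDiagramCat K M) :=
  fun X Y Ψ => ∀ x : SimplexCat K, ms.fib ((Ψ.hom : X.obj ⟶ Y.obj).app x)

/-- Cofibrations of bounded diagrams: `Ψ : F ⟶ G` such that for every non-degenerate
simplex `x` of `K` the canonical map `M_Ψ(x) ⟶ G(x)` is a cofibration in `M`. -/
def boundedCof [HasColimits M] (ms : ModelStructure M) (K : SSet.{0}) :
    MorphismProperty (BoundedDiagramCat K M) :=
  fun X Y Ψ => IsCofibrationOfDiagrams ms (show X.obj ⟶ Y.obj from Ψ.hom)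

/-- A small category `D` with a skeletal family `S` of objects on which the category is direct
(with degree function `deg`). -/
structure DirectData (D : Type) [SmallCategory D] where
  S : D → Prop
  deg : D → ℕ
  exists_iso : ∀ z : D, ∃ y, S y ∧ Nonempty (z ≅ y)
  deg_lt_or_eq : ∀ {x y : D}, S x → S y → (x ⟶ y) → deg x < deg y ∨ x = y
  endo_eq : ∀ {x : D}, S x → ∀ f : x ⟶ x, f = 𝟙 x

section AbstractFactorization

variable {D : Type} [SmallCategory D] {C : Type u} [Category.{v} C]

/-- The objects of degree `n` of the skeletal family. -/
abbrev DirectData.Level (T : DirectData D) (n : ℕ) := {y : D // T.S y ∧ T.deg y = n}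

/-- The inclusion of the objects of degree `n`. -/
abbrev DirectData.incl (T : DirectData D) (n : ℕ) : Discrete (T.Level n) ⥤ D :=
  Discrete.functor (fun y => y.1)

lemma DirectData.incl_full (T : DirectData D) (n : ℕ) : (T.incl n).Full where
  map_surjective := by
    rintro ⟨x⟩ ⟨y⟩ f
    have h := T.deg_lt_or_eq x.2.1 y.2.1 f
    have hxy : x = y := by
      rcases h with h | h
      · have := x.2.2; have := y.2.2; omega
      · exact Subtype.ext h
    subst hxy
    exact ⟨𝟙 _, by rw [CategoryTheory.Functor.map_id]; exact (T.endo_eq x.2.1 f).symm⟩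

lemma DirectData.incl_faithful (T : DirectData D) (n : ℕ) : (T.incl n).Faithful where
  map_injective := by
    intro x y f g _
    exact Subsingleton.elim _ _

lemma llp_of_discrete {J : Type} {A B : MorphismProperty C} (hAB : A ≤ B.llp)
    {F G : Discrete J ⥤ C} (i : F ⟶ G) (hi : ∀ j, A (i.app j)) {X Y : Discrete J ⥤ C}
    (p : X ⟶ Y) (hp : ∀ j, B (p.app j)) : HasLiftingProperty i p where
  sq_hasLift {f g} sq := by
    have sq' : ∀ j, CommSq (f.app j) (i.app j) (p.app j) (g.app j) := fun j =>
      ⟨NatTrans.congr_app sq.w j⟩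
    have hl : ∀ j, (sq' j).HasLift := fun j =>
      (hAB _ (hi j) _ (hp j)).sq_hasLift (sq' j)
    refine ⟨⟨⟨Discrete.natTrans (fun j => (sq' j).lift), ?_, ?_⟩⟩⟩
    · ext j; simp
    · ext j; simp

variable [HasColimits C]

theorem exists_factorization_step (T : DirectData D) {A B : MorphismProperty C} [B.RespectsIso]
    (hAB : A ≤ B.llp)
    (hfac : ∀ {X Y : C} (f : X ⟶ Y), ∃ (Z : C) (i : X ⟶ Z) (p : Z ⟶ Y), A i ∧ B p ∧ i ≫ p = f)
    (n : ℕ) {F G : D ⥤ C} (φ : F ⟶ G) :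
    ∃ (F' : D ⥤ C) (j : F ⟶ F') (φ' : F' ⟶ G), j ≫ φ' = φ ∧ (B.functorCategory D).llp j ∧
      (∀ y, T.S y → T.deg y < n → IsIso (j.app y)) ∧
      (∀ y, T.S y → T.deg y = n → B (φ'.app y)) := by
  have := T.incl_full n
  have := T.incl_faithful n
  choose Z i p hi hp hip using fun s : T.Level n => hfac (φ.app s.1)
  let L := T.incl n
  let Zf : Discrete (T.Level n) ⥤ C := Discrete.functor Z
  let u : L ⋙ F ⟶ Zf := Discrete.natTrans (fun s => i s.as)
  let q : Zf ⟶ L ⋙ G := Discrete.natTrans (fun s => p s.as)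
  have huq : u ≫ q = Functor.whiskerLeft L φ := by
    ext ⟨s⟩
    exact hip s
  let adj := L.lanAdjunction C
  let a : L.lan.obj (L ⋙ F) ⟶ F := adj.counit.app F
  let b : L.lan.obj (L ⋙ F) ⟶ L.lan.obj Zf := L.lan.map u
  let q' : L.lan.obj Zf ⟶ G := L.lan.map q ≫ adj.counit.app G
  have hw : a ≫ φ = b ≫ q' := by
    dsimp only [a, b, q']
    rw [← Functor.map_comp_assoc, huq]
    exact (adj.counit.naturality φ).symm
  have hb : (B.functorCategory D).llp b := by
    intro X Y r hr
    rw [adj.hasLiftingProperty_iff]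
    exact llp_of_discrete hAB u (fun s => hi s.as) _ (fun s => hr _)
  have hpo := IsPushout.of_hasPushout a b
  have hinr : pushout.inr a b ≫ pushout.desc φ q' hw = q' := pushout.inr_desc _ _ _
  refine ⟨pushout a b, pushout.inl a b, pushout.desc φ q' hw, pushout.inl_desc _ _ _, ?_, ?_, ?_⟩
  · exact MorphismProperty.of_isPushout hpo hb
  · intro y hy hyn
    have hpy := hpo.map ((evaluation D C).obj y)
    have hemp : IsEmpty (CostructuredArrow L y) := ⟨fun t => by
      rcases T.deg_lt_or_eq t.left.as.2.1 hy t.hom with h | h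
      · have := t.left.as.2.2; omega
      · have := t.left.as.2.2
        have h' : (t.left.as.1 : D) = y := h
        rw [h'] at this
        omega⟩
    have hini : ∀ H : Discrete (T.Level n) ⥤ C, Nonempty (IsInitial ((L.lan.obj H).obj y)) := by
      intro H
      have hc := Functor.isPointwiseLeftKanExtensionOfIsLeftKanExtension (L.lan.obj H)
        (L.lanUnit.app H) y
      exact ⟨isColimitEquivIsInitialOfIsEmpty _ _ hc⟩
    have : IsIso (((evaluation D C).obj y).map b) := by
      obtain ⟨h1⟩ := hini (L ⋙ F)
      obtain ⟨h2⟩ := hini Zf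
      exact isIso_of_isInitial h1 h2 _
    exact MorphismProperty.of_isPushout (P := MorphismProperty.isomorphisms C) hpy this
  · intro y hy hyn
    have hpy := hpo.map ((evaluation D C).obj y)
    let s : Discrete (T.Level n) := ⟨⟨y, hy, hyn⟩⟩
    have h1 : (L.lanUnit.app (L ⋙ F)).app s ≫ a.app y = 𝟙 _ :=
      L.lanUnit_app_app_lanAdjunction_counit_app_app F s
    have h2 : IsIso (a.app y) := by
      have h3 : IsIso ((L.lanUnit.app (L ⋙ F)).app s ≫ a.app y) := by
        rw [h1]; infer_instance
      exact IsIso.of_isIso_comp_left ((L.lanUnit.app (L ⋙ F)).app s) (a.app y)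
    have h4 : IsIso ((pushout.inr a b).app y) :=
      MorphismProperty.of_isPushout (P := MorphismProperty.isomorphisms C) hpy.flip h2
    have h5 : (L.lanUnit.app Zf).app s ≫ q'.app y = p s.as := by
      have h6 := congrArg (fun t => NatTrans.app t s) (L.lanUnit.naturality q)
      have h7 : (L.lanUnit.app (L ⋙ G)).app s ≫ (adj.counit.app G).app y = 𝟙 _ :=
        L.lanUnit_app_app_lanAdjunction_counit_app_app G s
      have h8 : p s.as ≫ (L.lanUnit.app (L ⋙ G)).app s =
        (L.lanUnit.app Zf).app s ≫ (L.lan.map q).app y := h6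
      dsimp only [q']
      rw [NatTrans.comp_app, ← Category.assoc, ← h8, Category.assoc, h7]
      exact Category.comp_id _
    have h9 : ((L.lanUnit.app Zf).app s ≫ (pushout.inr a b).app y) ≫
        (pushout.desc φ q' hw).app y = p s.as := by
      rw [← h5, Category.assoc, ← NatTrans.comp_app, hinr]
    have h10 : IsIso ((L.lanUnit.app Zf).app s ≫ (pushout.inr a b).app y) :=
      IsIso.comp_isIso' (inferInstanceAs (IsIso ((L.lanUnit.app Zf).app s))) h4
    have h11 := hp s.as
    rw [← h9] at h11
    exact (MorphismProperty.cancel_left_of_respectsIso B _ _).1 h11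

lemma llp_sequence {E : Type u₂} [Category.{v₂} E] (X : ℕ ⥤ E) [HasColimit X]
    (W : MorphismProperty E)
    (h : ∀ n, W.llp (X.map (homOfLE (Nat.le_add_right n 1)))) : W.llp (colimit.ι X 0) := by
  apply W.llp.transfiniteCompositionsOfShape_le ℕ
  have : X.IsWellOrderContinuous := inferInstance
  exact ⟨
    { F := X
      isoBot := Iso.refl _
      incl := (colimit.cocone X).ι
      isColimit := colimit.isColimit X
      fac := Category.id_comp _
      map_mem := fun n _ => h n }⟩

/-- A stage in the construction of the factorization. -/
structure FactStage {G : D ⥤ C} where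
  F : D ⥤ C
  φ : F ⟶ G

theorem exists_factorization (T : DirectData D) {A B : MorphismProperty C} [B.RespectsIso]
    (hAB : A ≤ B.llp)
    (hfac : ∀ {X Y : C} (f : X ⟶ Y), ∃ (Z : C) (i : X ⟶ Z) (p : Z ⟶ Y), A i ∧ B p ∧ i ≫ p = f)
    {F G : D ⥤ C} (φ : F ⟶ G) :
    ∃ (H : D ⥤ C) (j : F ⟶ H) (p : H ⟶ G), j ≫ p = φ ∧ (B.functorCategory D).llp j ∧
      B.functorCategory D p := by
  choose nF nj nφ h1 h2 h3 h4 using fun (n : ℕ) (E : FactStage (G := G)) =>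
    exists_factorization_step T hAB hfac n E.φ
  let E : ℕ → FactStage (G := G) := fun n =>
    Nat.rec ⟨F, φ⟩ (fun n e => ⟨nF n e, nφ n e⟩) n
  let f : ∀ n, (E n).F ⟶ (E (n + 1)).F := fun n => nj n (E n)
  have hf : ∀ n, f n ≫ (E (n + 1)).φ = (E n).φ := fun n => h1 n (E n)
  let X : ℕ ⥤ (D ⥤ C) := Functor.ofSequence f
  let c : Cocone X := ⟨G, NatTrans.ofSequence (fun n => (E n).φ) (fun n => by
    rw [Functor.ofSequence_map_homOfLE_succ]
    exact (hf n).trans (Category.comp_id _).symm)⟩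
  have hc : ∀ n, colimit.ι X n ≫ colimit.desc X c = (E n).φ := fun n => by
    rw [colimit.ι_desc]
    rfl
  refine ⟨colimit X, colimit.ι X 0, colimit.desc X c, hc 0, ?_, ?_⟩
  · refine llp_sequence X (B.functorCategory D) (fun n => ?_)
    rw [Functor.ofSequence_map_homOfLE_succ]
    exact h2 n (E n)
  · intro z
    obtain ⟨y, hy, ⟨e⟩⟩ := T.exists_iso z
    have hnat := (colimit.desc X c).naturality e.hom
    have hy' : B ((colimit.desc X c).app y) := by
      let m := T.deg y
      let Xy := X ⋙ (evaluation D C).obj y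
      have hiso : ∀ n, m + 1 ≤ n → IsIso (Xy.map (homOfLE (Nat.le_add_right n 1))) := by
        intro n hn
        dsimp only [Xy, Functor.comp_map]
        rw [Functor.ofSequence_map_homOfLE_succ]
        exact h3 n (E n) y hy (by omega)
      have hev : Xy.IsEventuallyConstantFrom (m + 1) := by
        intro n g
        have hle := leOfHom g
        obtain ⟨k, rfl⟩ := Nat.exists_eq_add_of_le hle
        induction k with
        | zero =>
          have : g = 𝟙 _ := Subsingleton.elim _ _
          rw [this]
          exact inferInstanceAs (IsIso (Xy.map (𝟙 _)))
        | succ k ih =>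
          have ih' := ih (homOfLE (by omega)) (by omega)
          have hk := hiso (m + 1 + k) (by omega)
          have : g = homOfLE (show m + 1 ≤ m + 1 + k by omega) ≫
            homOfLE (Nat.le_add_right (m + 1 + k) 1) := Subsingleton.elim _ _
          rw [this, Functor.map_comp]
          exact IsIso.comp_isIso' ih' hk
      have hι := hev.isIso_ι_of_isColimit
        (isColimitOfPreserves ((evaluation D C).obj y) (colimit.isColimit X))
      have hB : B ((E (m + 1)).φ.app y) := h4 m (E m) y hy rfl
      rw [← hc (m + 1), NatTrans.comp_app] at hB
      have hι' : IsIso ((colimit.ι X (m + 1)).app y) := hι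
      exact (MorphismProperty.cancel_left_of_respectsIso B
        ((colimit.ι X (m + 1)).app y) _).1 hB
    have h5 : B ((colimit.desc X c).app z ≫ G.map e.hom) := by
      have : B ((colimit X).map e.hom ≫ (colimit.desc X c).app y) :=
        (MorphismProperty.cancel_left_of_respectsIso B _ _).2 hy'
      rw [hnat] at this
      exact this
    exact (MorphismProperty.cancel_right_of_respectsIso B _ _).1 h5

end AbstractFactorization

section AbstractLifting

variable {D : Type} [SmallCategory D] {C : Type u} [Category.{v} C]

/-- The lifting problem for the relative latching map of `i` at `y`, where the latching object
is described by the maps into `y` which are not split epimorphisms. -/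
def LatchLift {A B : D ⥤ C} (i : A ⟶ B) (y : D) {X Y : C} (p : X ⟶ Y) : Prop :=
  ∀ (c : ∀ {z : D} (b : z ⟶ y), ¬ IsSplitEpi b → (B.obj z ⟶ X))
    (_ : ∀ {z z' : D} (g : z' ⟶ z) (b : z ⟶ y) (hb : ¬ IsSplitEpi b)
      (hgb : ¬ IsSplitEpi (g ≫ b)), B.map g ≫ c b hb = c (g ≫ b) hgb)
    (a : A.obj y ⟶ X) (e : B.obj y ⟶ Y)
    (_ : ∀ {z : D} (b : z ⟶ y) (hb : ¬ IsSplitEpi b), A.map b ≫ a = i.app z ≫ c b hb)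
    (_ : i.app y ≫ e = a ≫ p)
    (_ : ∀ {z : D} (b : z ⟶ y) (hb : ¬ IsSplitEpi b), c b hb ≫ p = B.map b ≫ e),
    ∃ l : B.obj y ⟶ X, i.app y ≫ l = a ∧
      (∀ {z : D} (b : z ⟶ y) (hb : ¬ IsSplitEpi b), B.map b ≫ l = c b hb) ∧ l ≫ p = e

lemma not_isSplitEpi_comp {x y z : D} (g : x ⟶ y) (b : y ⟶ z) (hb : ¬ IsSplitEpi b) :
    ¬ IsSplitEpi (g ≫ b) := by
  intro h
  exact hb ⟨⟨section_ (g ≫ b) ≫ g, by rw [Category.assoc, IsSplitEpi.id]⟩⟩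


lemma rlp_piMap {J : Type} {A₀ : MorphismProperty C} {f g : J → C} [HasProduct f] [HasProduct g]
    (p : ∀ j, f j ⟶ g j) (hp : ∀ j, A₀.rlp (p j)) : A₀.rlp (Limits.Pi.map p) := by
  intro X Y i hi
  refine ⟨fun {a b} sq => ?_⟩
  have hsq : ∀ j, CommSq (a ≫ Pi.π _ j) i (p j) (b ≫ Pi.π _ j) := fun j =>
    ⟨by rw [Category.assoc, ← Pi.map_π, ← Category.assoc, sq.w, Category.assoc]⟩
  have hl : ∀ j, (hsq j).HasLift := fun j => (hp j i hi).sq_hasLift (hsq j)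
  refine ⟨⟨⟨Pi.lift fun j => (hsq j).lift, ?_, ?_⟩⟩⟩
  · refine Pi.hom_ext _ _ fun j => ?_
    rw [Category.assoc, Pi.lift_π, (hsq j).fac_left]
  · refine Pi.hom_ext _ _ fun j => ?_
    rw [Category.assoc, Pi.map_π, Pi.lift_π_assoc, (hsq j).fac_right]

/-- Objectwise lifting property for maps with the lifting property against objectwise `B`. -/
lemma llp_app_of_llp_functorCategory [HasLimits C] {A₀ : MorphismProperty C}
    {A B : D ⥤ C} (j : A ⟶ B) (hj : (A₀.rlp.functorCategory D).llp j) (y : D) :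
    A₀.rlp.llp (j.app y) := by
  have : HasLimitsOfSize.{0, 0} C := hasLimitsOfSizeShrink.{0, 0, v, v} C
  intro X Y p hp
  refine ((evaluationAdjunctionLeft C y).hasLiftingProperty_iff j p).2 (hj _ ?_)
  intro z
  exact rlp_piMap (fun _ : (z ⟶ y) => p) (fun _ => hp)

open Classical in
/-- `1` for split epimorphisms and `0` for other maps. -/
noncomputable def splitIdx {z y : D} (b : z ⟶ y) : Fin 2 := if IsSplitEpi b then 1 else 0

lemma splitIdx_comp {x z y : D} (g : x ⟶ z) (b : z ⟶ y) : splitIdx (g ≫ b) ≤ splitIdx b := by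
  unfold splitIdx
  by_cases hb : IsSplitEpi b
  · simp only [hb, if_true]
    exact Fin.le_last _
  · simp only [hb, not_isSplitEpi_comp g b hb, if_false, le_refl]

lemma one_le_splitIdx {z y : D} (b : z ⟶ y) (hb : IsSplitEpi b) : 1 ≤ splitIdx b := by
  unfold splitIdx
  rw [if_pos hb]

section

variable [HasLimitsOfSize.{0, 0} C]

/-- Auxiliary functor: product over maps into `y` of the values of `P`. -/
noncomputable def coT (P : Fin 2 ⥤ C) (y : D) (k : ∀ z : D, (z ⟶ y) → Fin 2)
    (hk : ∀ (x z : D) (g : x ⟶ z) (b : z ⟶ y), k x (g ≫ b) ≤ k z b) : D ⥤ C where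
  obj z := ∏ᶜ fun b : z ⟶ y => P.obj (k _ b)
  map {z z'} g := Pi.lift fun b => Pi.π (fun b : z ⟶ y => P.obj (k _ b)) (g ≫ b) ≫
    P.map (homOfLE (hk _ _ g b))
  map_id z := by
    refine Pi.hom_ext _ _ fun b => ?_
    refine (Pi.lift_π _ _).trans ?_
    refine Eq.trans ?_ (Category.id_comp _).symm
    have : ∀ (b' : z ⟶ y) (h : b' = b) (h' : k _ b' ≤ k _ b),
        Pi.π (fun b : z ⟶ y => P.obj (k _ b)) b' ≫ P.map (homOfLE h') =
          Pi.π (fun b : z ⟶ y => P.obj (k _ b)) b := by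
      rintro _ rfl h'
      rw [Subsingleton.elim (homOfLE h') (𝟙 _), P.map_id, Category.comp_id]
    exact this _ (Category.id_comp b) _
  map_comp {z z' z''} g h := by
    refine Pi.hom_ext _ _ fun b => ?_
    refine (Pi.lift_π _ _).trans ?_
    refine Eq.trans ?_ (Category.assoc _ _ _).symm
    rw [Pi.lift_π, Pi.lift_π_assoc]
    refine Eq.trans ?_ (Category.assoc _ _ _).symm
    rw [← P.map_comp]
    have : ∀ (b' b'' : z ⟶ y) (_ : b' = b'') (h' : k _ b' ≤ k _ b)
        (h'' : k _ b'' ⟶ k _ b),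
        Pi.π (fun b : z ⟶ y => P.obj (k _ b)) b' ≫ P.map (homOfLE h') =
          Pi.π (fun b : z ⟶ y => P.obj (k _ b)) b'' ≫ P.map h'' := by
      rintro _ _ rfl h' h''
      rw [Subsingleton.elim (homOfLE h') h'']
    exact this _ _ (Category.assoc _ _ _) _ _

section

variable (P : Fin 2 ⥤ C) (y : D) (k : ∀ z : D, (z ⟶ y) → Fin 2)
    (hk : ∀ (x z : D) (g : x ⟶ z) (b : z ⟶ y), k x (g ≫ b) ≤ k z b)

/-- projections -/
noncomputable def coπ {z : D} (b : z ⟶ y) : (coT P y k hk).obj z ⟶ P.obj (k _ b) :=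
  Pi.π (fun b : z ⟶ y => P.obj (k _ b)) b

lemma co_hom_ext {z : D} {W : C} {f g : W ⟶ (coT P y k hk).obj z}
    (h : ∀ b : z ⟶ y, f ≫ coπ P y k hk b = g ≫ coπ P y k hk b) : f = g :=
  Pi.hom_ext _ _ h

lemma co_map_π {z z' : D} (g : z ⟶ z') (b : z' ⟶ y) : (coT P y k hk).map g ≫ coπ P y k hk b =
    coπ P y k hk (g ≫ b) ≫ P.map (homOfLE (hk _ _ g b)) :=
  Pi.lift_π _ _

lemma co_map_π_assoc {z z' : D} (g : z ⟶ z') (b : z' ⟶ y) {W : C} (r : P.obj (k _ b) ⟶ W) :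
    (coT P y k hk).map g ≫ coπ P y k hk b ≫ r =
      coπ P y k hk (g ≫ b) ≫ P.map (homOfLE (hk _ _ g b)) ≫ r := by
  rw [← Category.assoc, co_map_π, Category.assoc]

/-- lift -/
noncomputable def coLift {z : D} {W : C} (f : ∀ b : z ⟶ y, W ⟶ P.obj (k _ b)) :
    W ⟶ (coT P y k hk).obj z := Pi.lift f

lemma coLift_π {z : D} {W : C} (f : ∀ b : z ⟶ y, W ⟶ P.obj (k _ b)) (b : z ⟶ y) :
    coLift P y k hk f ≫ coπ P y k hk b = f b := Pi.lift_π _ _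

lemma coLift_π_assoc {z : D} {W : C} (f : ∀ b : z ⟶ y, W ⟶ P.obj (k _ b)) (b : z ⟶ y)
    {V : C} (r : P.obj (k _ b) ⟶ V) :
    coLift P y k hk f ≫ coπ P y k hk b ≫ r = f b ≫ r := by
  rw [← Category.assoc, coLift_π]

end

/-- Auxiliary functor. -/
noncomputable abbrev coR (P : Fin 2 ⥤ C) (y : D) : D ⥤ C := coT P y (fun _ _ => 0) (fun _ _ _ _ => le_rfl)

/-- Auxiliary functor. -/
noncomputable abbrev splitTarget (P : Fin 2 ⥤ C) (y : D) : D ⥤ C :=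
  coT P y (fun _ => splitIdx) (fun _ _ => splitIdx_comp)

/-- projections -/
noncomputable abbrev rπ (P : Fin 2 ⥤ C) (y : D) {z : D} (b : z ⟶ y) :
    (coR P y).obj z ⟶ P.obj 0 := coπ P y (fun _ _ => 0) (fun _ _ _ _ => le_rfl) b

/-- projections -/
noncomputable abbrev tπ (P : Fin 2 ⥤ C) (y : D) {z : D} (b : z ⟶ y) :
    (splitTarget P y).obj z ⟶ P.obj (splitIdx b) := coπ P y (fun _ => splitIdx) (fun _ _ => splitIdx_comp) b

lemma coR_map_π (P : Fin 2 ⥤ C) (y : D) {z z' : D} (g : z ⟶ z') (b : z' ⟶ y) :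
    (coR P y).map g ≫ rπ P y b = rπ P y (g ≫ b) := by
  rw [co_map_π]
  have := P.map_id 0
  exact (congrArg (fun t => coπ P y (fun _ _ => 0) (fun _ _ _ _ => le_rfl) (g ≫ b) ≫ t) this).trans
    (Category.comp_id _)

/-- Auxiliary natural transformation. -/
noncomputable def splitMap (P : Fin 2 ⥤ C) (y : D) : coR P y ⟶ splitTarget P y where
  app z := coLift _ _ _ _ fun b => rπ P y b ≫ P.map (homOfLE (Fin.zero_le _))
  naturality z z' g := by
    refine co_hom_ext _ _ _ _ fun b => ?_
    rw [Category.assoc, Category.assoc, coLift_π, co_map_π, coLift_π_assoc, co_map_π_assoc,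
      ← P.map_comp, Category.assoc, ← P.map_comp]
    rfl

lemma splitMap_π (P : Fin 2 ⥤ C) (y : D) {z : D} (b : z ⟶ y) :
    (splitMap P y).app z ≫ tπ P y b = rπ P y b ≫ P.map (homOfLE (Fin.zero_le _)) :=
  coLift_π P y (fun _ => splitIdx) (fun _ _ => splitIdx_comp)
    (fun b => rπ P y b ≫ P.map (homOfLE (Fin.zero_le _))) b

lemma splitMap_rlp (P : Fin 2 ⥤ C) (y : D) {A₀ : MorphismProperty C} (z : D)
    (h : ∀ b : z ⟶ y, A₀.rlp (P.map (homOfLE (Fin.zero_le (splitIdx b))))) :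
    A₀.rlp ((splitMap P y).app z) := by
  have : (splitMap P y).app z = Limits.Pi.map fun b : z ⟶ y =>
    P.map (homOfLE (Fin.zero_le (splitIdx b))) := by
      refine co_hom_ext _ _ _ _ fun b => ?_
      refine (splitMap_π P y b).trans ?_
      exact (Pi.map_π (f := fun _ : z ⟶ y => P.obj 0) (g := fun b : z ⟶ y => P.obj (splitIdx b))
        (fun b => P.map (homOfLE (Fin.zero_le (splitIdx b)))) b).symm
  rw [this]
  exact rlp_piMap (f := fun _ : z ⟶ y => P.obj 0) (g := fun b : z ⟶ y => P.obj (splitIdx b)) _ h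

open Classical in
lemma latchLift_of_llp_aux {A₀ : MorphismProperty C}
    {A B : D ⥤ C} (i : A ⟶ B) (hi : (A₀.rlp.functorCategory D).llp i) (y : D) (P : Fin 2 ⥤ C)
    (hP : A₀.rlp (P.map (homOfLE (Fin.zero_le 1)))) :
    LatchLift i y (P.map (homOfLE (Fin.zero_le 1))) := by
  intro c hc a e h₁ h₂ h₃
  have hs : A₀.rlp.functorCategory D (splitMap P y) := by
    intro z
    refine splitMap_rlp P y z fun b => ?_
    by_cases hb : IsSplitEpi b
    · have : splitIdx b = 1 := if_pos hb
      have hh : ∀ (k : Fin 2) (h : 0 ≤ k), k = 1 → A₀.rlp (P.map (homOfLE h)) := by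
        rintro _ h rfl; exact hP
      exact hh _ _ this
    · have : splitIdx b = 0 := if_neg hb
      have hh : ∀ (k : Fin 2) (h : 0 ≤ k), k = 0 → A₀.rlp (P.map (homOfLE h)) := by
        rintro _ h rfl
        rw [Subsingleton.elim (homOfLE h) (𝟙 _), P.map_id]
        exact MorphismProperty.id_mem _ _
      exact hh _ _ this
  let β : ∀ {z : D} (b : z ⟶ y), B.obj z ⟶ P.obj (splitIdx b) := fun {z} b =>
    if hb : IsSplitEpi b then B.map b ≫ e ≫ P.map (homOfLE (one_le_splitIdx b hb))
    else c b hb ≫ P.map (homOfLE (Fin.zero_le _))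
  have hβ₁ : ∀ {z : D} (b : z ⟶ y) (hb : IsSplitEpi b),
    β b = B.map b ≫ e ≫ P.map (homOfLE (one_le_splitIdx b hb)) := fun b hb => dif_pos hb
  have hβ₀ : ∀ {z : D} (b : z ⟶ y) (hb : ¬ IsSplitEpi b),
    β b = c b hb ≫ P.map (homOfLE (Fin.zero_le _)) := fun b hb => dif_neg hb
  let top : A ⟶ coR P y :=
    { app := fun z => coLift _ _ _ _ fun b => A.map b ≫ a
      naturality := fun z z' g => by
        refine co_hom_ext _ _ _ _ fun b => ?_
        refine (Category.assoc _ _ _).trans (Eq.trans ?_ (Category.assoc _ _ _).symm)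
        rw [coR_map_π, coLift_π, coLift_π, A.map_comp, Category.assoc] }
  let bot : B ⟶ splitTarget P y :=
    { app := fun z => coLift _ _ _ _ fun b => β b
      naturality := fun z z' g => by
        refine co_hom_ext _ _ _ _ fun b => ?_
        rw [Category.assoc, coLift_π, Category.assoc, co_map_π, coLift_π_assoc]
        by_cases hb : IsSplitEpi b
        · by_cases hgb : IsSplitEpi (g ≫ b)
          · rw [hβ₁ _ hb, hβ₁ _ hgb, B.map_comp]
            simp only [Category.assoc, ← P.map_comp]
            rfl
          · rw [hβ₁ _ hb, hβ₀ _ hgb, Category.assoc, ← P.map_comp, ← B.map_comp_assoc,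
              ← Category.assoc (B.map (g ≫ b)), ← h₃ _ hgb, Category.assoc, ← P.map_comp]
            rfl
        · have hgb := not_isSplitEpi_comp g b hb
          rw [hβ₀ _ hb, hβ₀ _ hgb, ← Category.assoc, hc g b hb hgb, Category.assoc, ← P.map_comp]
          rfl }
  have htop : ∀ {z : D} (b : z ⟶ y), top.app z ≫ rπ P y b = A.map b ≫ a := fun b =>
    coLift_π P y (fun _ _ => 0) (fun _ _ _ _ => le_rfl) (fun b => A.map b ≫ a) b
  have hbot : ∀ {z : D} (b : z ⟶ y), bot.app z ≫ tπ P y b = β b := fun b =>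
    coLift_π P y (fun _ => splitIdx) (fun _ _ => splitIdx_comp) (fun b => β b) b
  have sq : CommSq top i (splitMap P y) bot := ⟨by
    refine NatTrans.ext (funext fun z => co_hom_ext _ _ _ _ fun b => ?_)
    rw [NatTrans.comp_app, NatTrans.comp_app, Category.assoc, Category.assoc, splitMap_π, hbot,
      ← Category.assoc, htop]
    by_cases hb : IsSplitEpi b
    · rw [hβ₁ _ hb, ← i.naturality_assoc, ← Category.assoc (i.app y), h₂, Category.assoc,
        Category.assoc, ← P.map_comp]
      rfl
    · rw [hβ₀ _ hb, h₁ _ hb, Category.assoc]⟩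
  have := (hi _ hs).sq_hasLift sq
  have hl : ∀ {z : D} (b : z ⟶ y), B.map b ≫ sq.lift.app y ≫ rπ P y (𝟙 y)
      = sq.lift.app z ≫ rπ P y b := fun {z} b => by
    rw [sq.lift.naturality_assoc, coR_map_π, Category.comp_id]
  refine ⟨sq.lift.app y ≫ rπ P y (𝟙 y), ?_, fun {z} b hb => ?_, ?_⟩
  · rw [← Category.assoc, ← NatTrans.comp_app, sq.fac_left, htop, A.map_id, Category.id_comp]
  · rw [hl]
    have h := NatTrans.congr_app sq.fac_right z =≫ tπ P y b
    rw [NatTrans.comp_app, Category.assoc, hbot, splitMap_π, hβ₀ b hb, ← Category.assoc] at h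
    have h0 : splitIdx b = 0 := if_neg hb
    have hh : ∀ (k : Fin 2) (h : 0 ≤ k), k = 0 → IsIso (P.map (homOfLE h)) := by
      rintro _ h rfl
      rw [Subsingleton.elim (homOfLE h) (𝟙 _), P.map_id]
      infer_instance
    have := hh _ (Fin.zero_le _) h0
    exact (cancel_mono _).1 h
  · have h := NatTrans.congr_app sq.fac_right y =≫ tπ P y (𝟙 y)
    have h1 : IsSplitEpi (𝟙 y) := inferInstance
    rw [NatTrans.comp_app, Category.assoc, hbot, splitMap_π, hβ₁ _ h1, ← Category.assoc, B.map_id,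
      Category.id_comp] at h
    have h0 : splitIdx (𝟙 y) = 1 := if_pos h1
    have hh : ∀ (k : Fin 2) (h : 1 ≤ k), k = 1 → IsIso (P.map (homOfLE h)) := by
      rintro _ h rfl
      rw [Subsingleton.elim (homOfLE h) (𝟙 _), P.map_id]
      infer_instance
    have := hh _ (one_le_splitIdx _ h1) h0
    rw [← cancel_mono (P.map (homOfLE (one_le_splitIdx _ h1))), Category.assoc, ← P.map_comp]
    exact h

end

lemma latchLift_of_llp [HasLimits C] {A₀ : MorphismProperty C}
    {A B : D ⥤ C} (i : A ⟶ B) (hi : (A₀.rlp.functorCategory D).llp i) (y : D) {X Y : C}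
    (p : X ⟶ Y) (hp : A₀.rlp p) : LatchLift i y p := by
  have : HasLimitsOfSize.{0, 0} C := hasLimitsOfSizeShrink.{0, 0, v, v} C
  exact latchLift_of_llp_aux i hi y (ComposableArrows.mk₁ p) hp

end AbstractLifting

section AbstractLifting2

variable {D : Type} [SmallCategory D] {C : Type u} [Category.{v} C]

/-- Chosen representative in the skeletal family. -/
noncomputable def DirectData.rep (T : DirectData D) (z : D) : D := (T.exists_iso z).choose

lemma DirectData.S_rep (T : DirectData D) (z : D) : T.S (T.rep z) :=
  (T.exists_iso z).choose_spec.1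

/-- Chosen isomorphism with the representative. -/
noncomputable def DirectData.isoRep (T : DirectData D) (z : D) : z ≅ T.rep z :=
  (T.exists_iso z).choose_spec.2.some

lemma DirectData.deg_lt (T : DirectData D) {x y : D} (hx : T.S x) (hy : T.S y) (f : x ⟶ y)
    (hf : ¬ IsSplitEpi f) : T.deg x < T.deg y := by
  rcases T.deg_lt_or_eq hx hy f with h | h
  · exact h
  · subst h
    exact (hf (by rw [T.endo_eq hx f]; infer_instance)).elim

lemma DirectData.deg_rep_lt (T : DirectData D) {z y : D} (hy : T.S y) (b : z ⟶ y)
    (hb : ¬ IsSplitEpi b) : T.deg (T.rep z) < T.deg y :=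
  T.deg_lt (T.S_rep z) hy ((T.isoRep z).inv ≫ b) (not_isSplitEpi_comp _ _ hb)

variable {A B X Y : D ⥤ C}

/-- Partial lifts, defined on the objects of degree `< n` of the skeletal family. -/
structure PartialLift (T : DirectData D) (i : A ⟶ B) (p : X ⟶ Y) (a : A ⟶ X) (b : B ⟶ Y)
    (n : ℕ) where
  l : ∀ y, T.S y → T.deg y < n → (B.obj y ⟶ X.obj y)
  left : ∀ y hy h, i.app y ≫ l y hy h = a.app y
  right : ∀ y hy h, l y hy h ≫ p.app y = b.app y
  nat : ∀ y y' hy h hy' h' (f : y ⟶ y'), B.map f ≫ l y' hy' h' = l y hy h ≫ X.map f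

lemma PartialLift.exists_succ (T : DirectData D) (i : A ⟶ B) (p : X ⟶ Y) (a : A ⟶ X) (b : B ⟶ Y)
    (sq : CommSq a i p b) (hi : ∀ y, T.S y → LatchLift i y (p.app y))
    (n : ℕ) (s : PartialLift T i p a b n) :
    ∃ s' : PartialLift T i p a b (n + 1), ∀ y hy h h', s'.l y hy h' = s.l y hy h := by
  classical
  have hw : ∀ y, a.app y ≫ p.app y = i.app y ≫ b.app y := fun y => by
    rw [← NatTrans.comp_app, sq.w, NatTrans.comp_app]
  have key : ∀ y (_ : T.S y) (_ : T.deg y = n), ∃ l : B.obj y ⟶ X.obj y,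
      i.app y ≫ l = a.app y ∧ l ≫ p.app y = b.app y ∧
      ∀ z hz h (f : z ⟶ y), B.map f ≫ l = s.l z hz h ≫ X.map f := by
    intro y hy hyn
    obtain ⟨l, h₁, h₂, h₃⟩ := hi y hy
      (fun {z} f hf => B.map (T.isoRep z).hom ≫
        s.l (T.rep z) (T.S_rep z) (hyn ▸ T.deg_rep_lt hy f hf) ≫ X.map (T.isoRep z).inv ≫ X.map f)
      (fun {z z'} g f hf hgf => by
        have h := s.nat _ _ (T.S_rep z') (hyn ▸ T.deg_rep_lt hy _ hgf)
          (T.S_rep z) (hyn ▸ T.deg_rep_lt hy f hf) ((T.isoRep z').inv ≫ g ≫ (T.isoRep z).hom)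
        have h' := B.map (T.isoRep z').hom ≫= h =≫ (X.map (T.isoRep z).inv ≫ X.map f)
        simp only [Functor.map_comp, Category.assoc, Iso.map_hom_inv_id_assoc] at h'
        simp only [← Functor.map_comp_assoc, ← Functor.map_comp, Category.assoc] at h' ⊢
        simpa using h')
      (a.app y) (b.app y)
      (fun {z} f hf => by
        rw [← i.naturality_assoc, ← Category.assoc (i.app _), s.left, a.naturality_assoc,
          ← X.map_comp_assoc, Iso.hom_inv_id, X.map_id, Category.id_comp, a.naturality])
      (hw y).symm
      (fun {z} f hf => by
        simp only [Category.assoc]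
        rw [p.naturality, p.naturality_assoc, ← Category.assoc (s.l _ _ _), s.right,
          b.naturality_assoc, Iso.map_hom_inv_id_assoc, b.naturality])
    refine ⟨l, h₁, h₃, fun z hz h f => ?_⟩
    have hf : ¬ IsSplitEpi f := fun hf => by
      rcases T.deg_lt_or_eq hy hz (section_ f) with h' | h'
      · omega
      · subst h'; omega
    rw [h₂ f hf, ← Category.assoc (B.map _), s.nat z (T.rep z) hz h]
    simp
  choose l h₁ h₂ h₃ using key
  let l' : ∀ y, T.S y → T.deg y < n + 1 → (B.obj y ⟶ X.obj y) := fun y hy h =>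
    if h' : T.deg y < n then s.l y hy h' else l y hy (by omega)
  have hl₁ : ∀ y hy h h', l' y hy h = s.l y hy h' := fun y hy h h' => dif_pos h'
  have hl₂ : ∀ y hy h (h' : T.deg y = n), l' y hy h = l y hy h' := fun y hy h h' =>
    dif_neg (by omega)
  refine ⟨⟨l', ?_, ?_, ?_⟩, fun y hy h h' => hl₁ y hy h' h⟩
  · intro y hy h
    by_cases h' : T.deg y < n
    · rw [hl₁ y hy h h', s.left]
    · rw [hl₂ y hy h (by omega), h₁]
  · intro y hy h
    by_cases h' : T.deg y < n
    · rw [hl₁ y hy h h', s.right]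
    · rw [hl₂ y hy h (by omega), h₂]
  · intro y y' hy h hy' h' f
    rcases T.deg_lt_or_eq hy hy' f with hlt | heq
    · have hyn : T.deg y < n := by omega
      rw [hl₁ y hy h hyn]
      by_cases hn : T.deg y' < n
      · rw [hl₁ y' hy' h' hn, s.nat]
      · rw [hl₂ y' hy' h' (by omega), h₃]
    · subst heq
      rw [T.endo_eq hy f]
      simp

theorem hasLiftingProperty_of_latchLift (T : DirectData D) (i : A ⟶ B) (p : X ⟶ Y)
    (hi : ∀ y, T.S y → LatchLift i y (p.app y)) : HasLiftingProperty i p := by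
  refine ⟨fun {a b} sq => ?_⟩
  let s : ∀ n, PartialLift T i p a b n := fun n => Nat.rec
    ⟨fun _ _ h => (Nat.not_lt_zero _ h).elim, fun _ _ h => (Nat.not_lt_zero _ h).elim,
      fun _ _ h => (Nat.not_lt_zero _ h).elim, fun _ _ _ h => (Nat.not_lt_zero _ h).elim⟩
    (fun n s => (PartialLift.exists_succ T i p a b sq hi n s).choose) n
  have hs : ∀ n y hy h h', (s (n + 1)).l y hy h' = (s n).l y hy h := fun n =>
    (PartialLift.exists_succ T i p a b sq hi n (s n)).choose_spec
  have hs' : ∀ k n y hy h h', (s (n + k)).l y hy h' = (s n).l y hy h := by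
    intro k
    induction k with
    | zero => intro n y hy h h'; rfl
    | succ k ih =>
      intro n y hy h h'
      exact (hs (n + k) y hy (by omega) h').trans (ih n y hy h _)
  let l : ∀ y, T.S y → (B.obj y ⟶ X.obj y) := fun y hy => (s (T.deg y + 1)).l y hy (by omega)
  have hl : ∀ y hy m (h : T.deg y < m), l y hy = (s m).l y hy h := fun y hy m h => by
    obtain ⟨k, rfl⟩ := Nat.exists_eq_add_of_lt h
    have : T.deg y + k + 1 = (T.deg y + 1) + k := by omega
    revert h
    rw [this]
    intro h
    exact (hs' k _ y hy (by omega) _).symm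
  have hnat : ∀ y y' hy hy' (f : y ⟶ y'), B.map f ≫ l y' hy' = l y hy ≫ X.map f := by
    intro y y' hy hy' f
    rw [hl y hy (T.deg y + T.deg y' + 1) (by omega), hl y' hy' (T.deg y + T.deg y' + 1) (by omega),
      (s _).nat]
  refine ⟨⟨⟨
    { app := fun z => B.map (T.isoRep z).hom ≫ l (T.rep z) (T.S_rep z) ≫ X.map (T.isoRep z).inv
      naturality := fun z' z g => ?_ }, ?_, ?_⟩⟩⟩
  · have h := hnat _ _ (T.S_rep z') (T.S_rep z) ((T.isoRep z').inv ≫ g ≫ (T.isoRep z).hom)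
    have h' := B.map (T.isoRep z').hom ≫= h =≫ (X.map (T.isoRep z).inv)
    simp only [Functor.map_comp, Category.assoc, Iso.map_hom_inv_id_assoc] at h'
    simp only [← Functor.map_comp_assoc, ← Functor.map_comp, Category.assoc] at h' ⊢
    simpa using h'
  · refine NatTrans.ext (funext fun z => ?_)
    rw [NatTrans.comp_app, ← i.naturality_assoc, ← Category.assoc (i.app _), (s _).left,
      ← a.naturality, ← A.map_comp_assoc]
    simp
  · refine NatTrans.ext (funext fun z => ?_)
    rw [NatTrans.comp_app, Category.assoc, Category.assoc, p.naturality,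
      ← Category.assoc (l _ _), (s _).right, ← b.naturality, ← B.map_comp_assoc]
    simp

end AbstractLifting2

section Simplicial

variable {K : SSet.{0}}

namespace SimplexAux

/-- The underlying object of `Δ`. -/
abbrev dim (x : SimplexCat K) : SimplexCategory := x.unop.1.unop

/-- The underlying map in `Δ`. -/
abbrev und {x y : SimplexCat K} (f : x ⟶ y) : dim x ⟶ dim y := f.unop.val.unop

/-- The underlying map is surjective. -/
abbrev Sur {x y : SimplexCat K} (f : x ⟶ y) : Prop :=
  Function.Surjective f.unop.val.unop.toOrderHom

/-- Non-degenerate simplices. -/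
abbrev Nondeg (x : SimplexCat K) : Prop := ¬ IsDegenerate x.unop

lemma hom_ext {x y : SimplexCat K} {f g : x ⟶ y} (h : und f = und g) : f = g := by
  apply Quiver.Hom.unop_inj
  apply Subtype.ext
  exact Quiver.Hom.unop_inj h

lemma hom_ext' {x y : SimplexCat K} {f g : x ⟶ y}
    (h : ∀ i, (und f).toOrderHom i = (und g).toOrderHom i) : f = g :=
  hom_ext (SimplexCategory.Hom.ext _ _ (OrderHom.ext _ _ (funext h)))

lemma und_w {x y : SimplexCat K} (f : x ⟶ y) : K.map (und f).op y.unop.2 = x.unop.2 :=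
  f.unop.property

/-- Constructor for morphisms. -/
def mkHom {x y : SimplexCat K} (α : dim x ⟶ dim y) (h : K.map α.op y.unop.2 = x.unop.2) :
    x ⟶ y :=
  Quiver.Hom.op (CategoryOfElements.homMk y.unop x.unop α.op h)

lemma und_mkHom {x y : SimplexCat K} (α : dim x ⟶ dim y) (h : K.map α.op y.unop.2 = x.unop.2) :
    und (mkHom α h) = α := rfl

lemma comp_apply {x y z : SimplexCat K} (f : x ⟶ y) (g : y ⟶ z) (i) :
    (und (f ≫ g)).toOrderHom i = (und g).toOrderHom ((und f).toOrderHom i) := rfl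

lemma id_apply {x : SimplexCat K} (i) :
    (und (𝟙 x)).toOrderHom i = i := rfl

lemma exists_section {w y : SimplexCat K} (f : w ⟶ y)
    (s : Fin ((dim y).len + 1) → Fin ((dim w).len + 1))
    (hs : ∀ i, (und f).toOrderHom (s i) = i) :
    ∃ g : y ⟶ w, g ≫ f = 𝟙 y ∧ ∀ i, (und g).toOrderHom i = s i := by
  let s' : dim y ⟶ dim w := SimplexCategory.Hom.mk ⟨s, by
    intro i j hij
    by_contra h
    have h1 := (und f).toOrderHom.monotone (not_le.1 h).le
    rw [hs, hs] at h1
    have := le_antisymm hij h1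
    subst this
    exact h le_rfl⟩
  have h1 : s' ≫ und f = 𝟙 _ := SimplexCategory.Hom.ext _ _ (OrderHom.ext _ _ (funext hs))
  refine ⟨mkHom s' ?_, ?_, fun i => rfl⟩
  · rw [← und_w f, ← FunctorToTypes.map_comp_apply, ← op_comp, h1, op_id,
      FunctorToTypes.map_id_apply]
  · exact hom_ext' hs

lemma injective_of_nondeg {x z : SimplexCat K} (hx : Nondeg x) (f : x ⟶ z) :
    Function.Injective (und f).toOrderHom := by
  have hfac : factorThruImage (und f) ≫ image.ι (und f) = und f := image.fac _
  have he : Function.Surjective (factorThruImage (und f)).toOrderHom :=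
    SimplexCategory.epi_iff_surjective.1 inferInstance
  have hm : Function.Injective (image.ι (und f)).toOrderHom :=
    SimplexCategory.mono_iff_injective.1 inferInstance
  have hle : (dim x).len ≤ (image (und f)).len := by
    by_contra h
    refine hx ⟨image (und f), factorThruImage (und f), K.map (image.ι (und f)).op z.unop.2, he,
      not_le.1 h, ?_⟩
    rw [← FunctorToTypes.map_comp_apply, ← op_comp, hfac, und_w]
  have hb := he.bijective_of_nat_card_le (by simp; exact hle)
  rw [← hfac]
  exact hm.comp hb.1

lemma endo_of_nondeg {x : SimplexCat K} (hx : Nondeg x) (f : x ⟶ x) : f = 𝟙 x := by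
  apply hom_ext
  have : Mono (und f) := SimplexCategory.mono_iff_injective.2 (injective_of_nondeg hx f)
  exact SimplexCategory.eq_id_of_mono _

lemma len_lt_or_eq {x y : SimplexCat K} (hx : Nondeg x) (f : x ⟶ y) :
    (dim x).len < (dim y).len ∨ x = y := by
  have hinj := injective_of_nondeg hx f
  have hle : (dim x).len ≤ (dim y).len := by
    have := Fintype.card_le_of_injective _ hinj
    simpa using this
  rcases hle.lt_or_eq with h | h
  · exact Or.inl h
  · right
    obtain ⟨⟨⟨a⟩, s⟩⟩ := x
    obtain ⟨⟨⟨b⟩, t⟩⟩ := y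
    obtain rfl : a = b := SimplexCategory.ext h
    have : Mono (und f) := SimplexCategory.mono_iff_injective.2 hinj
    have h1 : und f = 𝟙 a := SimplexCategory.eq_id_of_mono (x := a) (und f)
    have h2 := und_w f
    rw [h1, op_id, FunctorToTypes.map_id_apply] at h2
    exact congrArg op (congrArg (fun s => (⟨op a, s⟩ : K.Elements)) h2.symm)

lemma exists_sur_nondeg (z : SimplexCat K) : ∃ (x : SimplexCat K) (f : z ⟶ x), Nondeg x ∧ Sur f := by
  induction hn : (dim z).len using Nat.strong_induction_on generalizing z with
  | _ n ih =>
    by_cases hz : Nondeg z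
    · exact ⟨z, 𝟙 z, hz, fun i => ⟨i, rfl⟩⟩
    · obtain ⟨m, α, τ, hα, hm, hτ⟩ := not_not.1 hz
      let y : SimplexCat K := op (K.elementsMk (op m) τ)
      obtain ⟨x, f, hx, hf⟩ := ih m.len (hn ▸ hm) y rfl
      let g : z ⟶ y := mkHom α hτ
      exact ⟨x, g ≫ f, hx, hf.comp hα⟩

/-- Eilenberg–Zilber type factorization. -/
lemma exists_factor {w x y : SimplexCat K} (hx : Nondeg x) (f : w ⟶ x) (hf : Sur f)
    (α : w ⟶ y) (hα : Sur α) : ∃ g : y ⟶ x, α ≫ g = f := by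
  have key : ∀ i j, (und α).toOrderHom i = (und α).toOrderHom j →
      (und f).toOrderHom i = (und f).toOrderHom j := by
    intro i j hij
    by_contra hne
    choose t ht using hf
    obtain ⟨s, hs, hs'⟩ := exists_section f
      (Function.update (Function.update t ((und f).toOrderHom i) i) ((und f).toOrderHom j) j)
      (by
        intro k
        by_cases hk : k = (und f).toOrderHom j
        · subst hk; rw [Function.update_self]
        · rw [Function.update_of_ne hk]
          by_cases hk' : k = (und f).toOrderHom i
          · subst hk'; rw [Function.update_self]
          · rw [Function.update_of_ne hk']; exact ht k)
    refine hne (injective_of_nondeg hx (s ≫ α) ?_)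
    rw [comp_apply, comp_apply, hs', hs', Function.update_self, Function.update_of_ne hne,
      Function.update_self, hij]
  choose t ht using hα
  obtain ⟨s, hs, hs'⟩ := exists_section α t ht
  refine ⟨s ≫ f, hom_ext' fun i => ?_⟩
  rw [comp_apply, comp_apply]
  apply key
  rw [hs', ht]

variable (K) in
/-- The relation generated by inverting surjections. -/
def rel : HomRel (SimplexCat K) := fun _ b m₁ m₂ =>
  ∃ (y : SimplexCat K) (α : b ⟶ y), Sur α ∧ m₁ ≫ α = m₂ ≫ α

variable (K) in
/-- The localization of the simplex category at the surjections. -/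
abbrev QCat := CategoryTheory.Quotient (rel K)

variable (K) in
/-- The quotient functor. -/
abbrev qF : SimplexCat K ⥤ QCat K := Quotient.functor (rel K)

lemma isIso_qF_map {x y : SimplexCat K} (f : x ⟶ y) (hf : Sur f) : IsIso ((qF K).map f) := by
  choose t ht using hf
  obtain ⟨s, hs, -⟩ := exists_section f t ht
  refine ⟨(qF K).map s, ?_, ?_⟩
  · rw [← (qF K).map_comp, ← (qF K).map_id]
    exact CategoryTheory.Quotient.sound _ ⟨y, f, fun i => ⟨t i, ht i⟩, by
      rw [Category.assoc, hs, Category.comp_id, Category.id_comp]⟩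
  · rw [← (qF K).map_comp, hs, (qF K).map_id]

lemma isSplitEpi_qF_map_iff {z x : SimplexCat K} (hx : Nondeg x) (f : z ⟶ x) :
    IsSplitEpi ((qF K).map f) ↔ Sur f := by
  constructor
  · intro h
    obtain ⟨g, hg⟩ := (qF K).map_surjective (section_ ((qF K).map f))
    have h1 := endo_of_nondeg hx (g ≫ f)
    intro i
    refine ⟨(und g).toOrderHom i, ?_⟩
    rw [← comp_apply, h1, id_apply]
  · intro h
    have := isIso_qF_map f h
    infer_instance

variable (K) in
/-- The localized simplex category is a direct category up to equivalence. -/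
def directData : DirectData (QCat K) where
  S z := Nondeg z.as
  deg z := (dim z.as).len
  exists_iso := by
    rintro ⟨z⟩
    obtain ⟨x, f, hx, hf⟩ := exists_sur_nondeg z
    have := isIso_qF_map f hf
    exact ⟨(qF K).obj x, hx, ⟨asIso ((qF K).map f)⟩⟩
  deg_lt_or_eq := by
    rintro ⟨x⟩ ⟨y⟩ hx hy f
    obtain ⟨f, rfl⟩ := (qF K).map_surjective (X := x) (Y := y) f
    rcases len_lt_or_eq hx f with h | h
    · exact Or.inl h
    · exact Or.inr (congrArg (fun t => (⟨t⟩ : QCat K)) h)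
  endo_eq := by
    rintro ⟨x⟩ hx f
    obtain ⟨f, rfl⟩ := (qF K).map_surjective (X := x) (Y := x) f
    rw [endo_of_nondeg hx f]
    rfl

end SimplexAux

end Simplicial

section Comparison

variable {K : SSet.{0}} {N : Type u} [Category.{v} N]

namespace SimplexAux

lemma bounded_rel {F : SimplexCat K ⥤ N} (hF : BoundedDiagram F) (x y : SimplexCat K)
    (f₁ f₂ : x ⟶ y) (h : rel K f₁ f₂) : F.map f₁ = F.map f₂ := by
  obtain ⟨z, α, hα, h⟩ := h
  have := hF α hα
  rw [← cancel_mono (F.map α), ← F.map_comp, h, F.map_comp]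

variable (K N) in
/-- Bounded diagrams as diagrams on the localized simplex category. -/
def toQ : BoundedDiagramCat K N ⥤ (QCat K ⥤ N) where
  obj F := CategoryTheory.Quotient.lift (rel K) F.obj (bounded_rel F.property)
  map {F G} φ := CategoryTheory.Quotient.natTransLift (rel K)
    (F := CategoryTheory.Quotient.lift (rel K) F.obj (bounded_rel F.property))
    (G := CategoryTheory.Quotient.lift (rel K) G.obj (bounded_rel G.property)) φ.hom
  map_id F := rfl
  map_comp f g := rfl

lemma toQ_map_app {F G : BoundedDiagramCat K N} (φ : F ⟶ G) (z : SimplexCat K) :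
    ((toQ K N).map φ).app ((qF K).obj z) = φ.hom.app z := rfl

lemma toQ_obj_map (F : BoundedDiagramCat K N) {x y : SimplexCat K} (f : x ⟶ y) :
    ((toQ K N).obj F).map ((qF K).map f) = F.obj.map f := rfl

instance toQ_faithful : (toQ K N).Faithful where
  map_injective {F G φ ψ} h := by
    apply ObjectProperty.hom_ext
    ext z
    exact NatTrans.congr_app h ((qF K).obj z)

instance toQ_full : (toQ K N).Full where
  map_surjective {F G} ψ :=
    ⟨ObjectProperty.homMk
      { app := fun z => ψ.app ((qF K).obj z)
        naturality := fun _ _ f => ψ.naturality ((qF K).map f) }, rfl⟩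

instance toQ_essSurj : (toQ K N).EssSurj where
  mem_essImage H :=
    ⟨⟨qF K ⋙ H, fun e he => by
      have := isIso_qF_map e he
      exact inferInstanceAs (IsIso (H.map ((qF K).map e)))⟩,
      ⟨CategoryTheory.Quotient.natIsoLift (rel K) (Iso.refl (qF K ⋙ H))⟩⟩

instance toQ_isEquivalence : (toQ K N).IsEquivalence where

/-- Index category of the boundary. -/
def Bdry (x : SimplexCat K) := ObjectProperty.FullSubcategory
  (fun g : Over x.unop.1.unop => ¬ Function.Surjective g.hom.toOrderHom)

instance (x : SimplexCat K) : SmallCategory (Bdry x) :=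
  inferInstanceAs (SmallCategory (ObjectProperty.FullSubcategory
    (fun g : Over x.unop.1.unop => ¬ Function.Surjective g.hom.toOrderHom)))

/-- The face associated to an object of the boundary. -/
def bO {x : SimplexCat K} (g : Bdry x) : SimplexCat K := (toK x.unop).obj g.obj

/-- The inclusion of a face. -/
def bV {x : SimplexCat K} (g : Bdry x) : bO g ⟶ x := toVertexHom x.unop g.obj

/-- The map between faces. -/
def bM {x : SimplexCat K} {g g' : Bdry x} (t : g ⟶ g') : bO g ⟶ bO g' :=
  (toK x.unop).map t.hom

lemma bM_bV {x : SimplexCat K} {g g' : Bdry x} (t : g ⟶ g') : bM t ≫ bV g' = bV g :=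
  toVertexHom_natural x.unop t.hom

lemma bV_not_sur {x : SimplexCat K} (g : Bdry x) : ¬ Sur (bV g) := g.property

/-- The object of the boundary associated to a non surjective map. -/
def bdryObj {x z : SimplexCat K} (f : z ⟶ x) (hf : ¬ Sur f) : Bdry x := ⟨Over.mk (und f), hf⟩

/-- The canonical map to the restriction along the simplex `x`. -/
def theta {x z : SimplexCat K} (f : z ⟶ x) (hf : ¬ Sur f) : z ⟶ bO (bdryObj f hf) :=
  mkHom (x := z) (y := bO (bdryObj f hf)) (𝟙 (dim z))
    ((FunctorToTypes.map_id_apply K _).trans (und_w f))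

lemma theta_comp {x z : SimplexCat K} (f : z ⟶ x) (hf : ¬ Sur f) :
    theta f hf ≫ bV (bdryObj f hf) = f := hom_ext' fun _ => rfl

lemma exists_bM {x z z' : SimplexCat K} (g : z' ⟶ z) (f : z ⟶ x)
    (hf : ¬ Sur f) (hgf : ¬ Sur (g ≫ f)) :
    ∃ t : bdryObj (g ≫ f) hgf ⟶ bdryObj f hf, theta (g ≫ f) hgf ≫ bM t = g ≫ theta f hf :=
  ⟨ObjectProperty.homMk (Over.homMk (und g) rfl), hom_ext' fun _ => rfl⟩

lemma exists_bM' {x : SimplexCat K} (g : Bdry x) (hg : ¬ Sur (bV g)) :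
    ∃ t : bdryObj (bV g) hg ⟶ g, theta (bV g) hg ≫ bM t = 𝟙 _ :=
  ⟨ObjectProperty.homMk (Over.homMk (𝟙 _) (Category.id_comp _)), hom_ext' fun _ => rfl⟩

section

variable [HasColimits N]

/-- The latching object. -/
noncomputable def Lat (F : SimplexCat K ⥤ N) (x : SimplexCat K) : N :=
  colimit (bdryRestrict x.unop F)

/-- The inclusion in the latching object. -/
noncomputable def lι (F : SimplexCat K ⥤ N) {x : SimplexCat K} (g : Bdry x) :
    F.obj (bO g) ⟶ Lat F x :=
  colimit.ι (bdryRestrict x.unop F) g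

lemma lι_w (F : SimplexCat K ⥤ N) {x : SimplexCat K} {g g' : Bdry x} (t : g ⟶ g') :
    F.map (bM t) ≫ lι F g' = lι F g :=
  colimit.w (bdryRestrict x.unop F) t

lemma lι_hom_ext (F : SimplexCat K ⥤ N) {x : SimplexCat K} {X : N} {f f' : Lat F x ⟶ X}
    (h : ∀ g, lι F g ≫ f = lι F g ≫ f') : f = f' :=
  colimit.hom_ext h

lemma lι_desc (F : SimplexCat K ⥤ N) {x : SimplexCat K} {X : N}
    (c : ∀ g : Bdry x, F.obj (bO g) ⟶ X)
    (hc : ∀ {g g' : Bdry x} (t : g ⟶ g'), F.map (bM t) ≫ c g' = c g) :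
    ∃ d : Lat F x ⟶ X, ∀ g, lι F g ≫ d = c g :=
  ⟨colimit.desc (bdryRestrict x.unop F)
    { pt := X
      ι :=
        { app := c
          naturality := fun _ _ t => (hc t).trans (Category.comp_id _).symm } },
    fun _ => colimit.ι_desc _ _⟩

/-- The map from the latching object. -/
noncomputable def vert (F : SimplexCat K ⥤ N) (x : SimplexCat K) : Lat F x ⟶ F.obj x :=
  bdryToVertex x.unop F

lemma lι_vert (F : SimplexCat K ⥤ N) {x : SimplexCat K} (g : Bdry x) :
    lι F g ≫ vert F x = F.map (bV g) :=
  colimit.ι_desc (bdryCocone x.unop F) g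

/-- Functoriality of the latching object. -/
noncomputable def lmap {F G : SimplexCat K ⥤ N} (φ : F ⟶ G) (x : SimplexCat K) :
    Lat F x ⟶ Lat G x := bdryMap x.unop φ

lemma lι_lmap {F G : SimplexCat K ⥤ N} (φ : F ⟶ G) {x : SimplexCat K} (g : Bdry x) :
    lι F g ≫ lmap φ x = φ.app (bO g) ≫ lι G g := by
  let α : bdryRestrict x.unop F ⟶ bdryRestrict x.unop G :=
    Functor.whiskerLeft (ObjectProperty.ι _ ⋙ toK x.unop) φ
  exact ι_colimMap α g

/-- The pushout. -/
noncomputable def PP {F G : SimplexCat K ⥤ N} (φ : F ⟶ G) (x : SimplexCat K) : N :=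
  pushout (bdryToVertex x.unop F) (bdryMap x.unop φ)

/-- The first inclusion. -/
noncomputable def pinl {F G : SimplexCat K ⥤ N} (φ : F ⟶ G) (x : SimplexCat K) :
    F.obj x ⟶ PP φ x :=
  pushout.inl (bdryToVertex x.unop F) (bdryMap x.unop φ)

/-- The second inclusion. -/
noncomputable def pinr {F G : SimplexCat K ⥤ N} (φ : F ⟶ G) (x : SimplexCat K) :
    Lat G x ⟶ PP φ x :=
  pushout.inr (bdryToVertex x.unop F) (bdryMap x.unop φ)

lemma pcond {F G : SimplexCat K ⥤ N} (φ : F ⟶ G) (x : SimplexCat K) :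
    vert F x ≫ pinl φ x = lmap φ x ≫ pinr φ x :=
  pushout.condition

lemma PP_hom_ext {F G : SimplexCat K ⥤ N} (φ : F ⟶ G) (x : SimplexCat K) {X : N}
    {f f' : PP φ x ⟶ X} (h : pinl φ x ≫ f = pinl φ x ≫ f') (h' : pinr φ x ≫ f = pinr φ x ≫ f') :
    f = f' := pushout.hom_ext h h'

lemma PP_desc {F G : SimplexCat K ⥤ N} (φ : F ⟶ G) (x : SimplexCat K) {X : N}
    (a : F.obj x ⟶ X) (d : Lat G x ⟶ X) (h : vert F x ≫ a = lmap φ x ≫ d) :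
    ∃ f : PP φ x ⟶ X, pinl φ x ≫ f = a ∧ pinr φ x ≫ f = d :=
  ⟨pushout.desc a d h, pushout.inl_desc _ _ _, pushout.inr_desc _ _ _⟩

/-- The latching comparison. -/
noncomputable def lc {F G : SimplexCat K ⥤ N} (φ : F ⟶ G) (x : SimplexCat K) :
    PP φ x ⟶ G.obj x := latchingComparison x.unop φ

lemma pinl_lc {F G : SimplexCat K ⥤ N} (φ : F ⟶ G) (x : SimplexCat K) :
    pinl φ x ≫ lc φ x = φ.app x := pushout.inl_desc _ _ _

lemma pinr_lc {F G : SimplexCat K ⥤ N} (φ : F ⟶ G) (x : SimplexCat K) :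
    pinr φ x ≫ lc φ x = vert G x := pushout.inr_desc _ _ _

/-- The canonical map to the latching object. -/
noncomputable def cmap (F : SimplexCat K ⥤ N) {x z : SimplexCat K} (f : z ⟶ x) (hf : ¬ Sur f) :
    F.obj z ⟶ Lat F x :=
  F.map (theta f hf) ≫ lι F (bdryObj f hf)

lemma map_cmap (F : SimplexCat K ⥤ N) {x z z' : SimplexCat K} (g : z' ⟶ z) (f : z ⟶ x)
    (hf : ¬ Sur f) (hgf : ¬ Sur (g ≫ f)) : F.map g ≫ cmap F f hf = cmap F (g ≫ f) hgf := by
  obtain ⟨t, h⟩ := exists_bM g f hf hgf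
  unfold cmap
  rw [← lι_w F t, ← Category.assoc, ← Category.assoc, ← F.map_comp, ← F.map_comp, h]

lemma cmap_bV (F : SimplexCat K ⥤ N) {x : SimplexCat K} (g : Bdry x) :
    cmap F (bV g) (bV_not_sur g) = lι F g := by
  obtain ⟨t, h⟩ := exists_bM' g (bV_not_sur g)
  unfold cmap
  rw [← lι_w F t, ← Category.assoc, ← F.map_comp, h, F.map_id, Category.id_comp]

lemma cmap_vert (F : SimplexCat K ⥤ N) {x z : SimplexCat K} (f : z ⟶ x) (hf : ¬ Sur f) :
    cmap F f hf ≫ vert F x = F.map f := by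
  unfold cmap
  rw [Category.assoc, lι_vert, ← F.map_comp, theta_comp]

lemma cmap_lmap {F G : SimplexCat K ⥤ N} (φ : F ⟶ G) {x z : SimplexCat K} (f : z ⟶ x)
    (hf : ¬ Sur f) :
    cmap F f hf ≫ lmap φ x = φ.app z ≫ cmap G f hf := by
  unfold cmap
  rw [Category.assoc, lι_lmap, ← φ.naturality_assoc]

lemma cmap_hom_ext (F : SimplexCat K ⥤ N) {x : SimplexCat K} {X : N} {d d' : Lat F x ⟶ X}
    (h : ∀ {z} (f : z ⟶ x) (hf : ¬ Sur f), cmap F f hf ≫ d = cmap F f hf ≫ d') : d = d' :=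
  lι_hom_ext F fun g => by rw [← cmap_bV]; exact h _ _

lemma cmap_desc (F : SimplexCat K ⥤ N) {x : SimplexCat K} {X : N}
    (c : ∀ {z} (f : z ⟶ x) (_ : ¬ Sur f), F.obj z ⟶ X)
    (hc : ∀ {z z'} (g : z' ⟶ z) (f : z ⟶ x) (hf : ¬ Sur f) (hgf : ¬ Sur (g ≫ f)),
      F.map g ≫ c f hf = c (g ≫ f) hgf) :
    ∃ d : Lat F x ⟶ X, ∀ {z} (f : z ⟶ x) (hf : ¬ Sur f), cmap F f hf ≫ d = c f hf := by
  have hcc : ∀ {z} (f f' : z ⟶ x) (hf hf'), f = f' → c f hf = c f' hf' := by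
    rintro z f _ hf hf' rfl; rfl
  obtain ⟨d, hd⟩ := lι_desc F (fun g => c (bV g) (bV_not_sur g)) (fun {g g'} t => by
    have h2 : ¬ Sur (bM t ≫ bV g') := by rw [bM_bV]; exact bV_not_sur g
    exact (hc _ _ _ h2).trans (hcc _ _ _ _ (bM_bV t)))
  refine ⟨d, fun {z} f hf => ?_⟩
  unfold cmap
  rw [Category.assoc, hd]
  have h2 : ¬ Sur (theta f hf ≫ bV (bdryObj f hf)) := by rw [theta_comp]; exact hf
  exact (hc _ _ _ h2).trans (hcc _ _ _ _ (theta_comp f hf))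

lemma sur_of_comp {x y z : SimplexCat K} (g : z ⟶ y) (f : y ⟶ x) (h : Sur (g ≫ f)) : Sur f :=
  Function.Surjective.of_comp (g := (und g).toOrderHom) h

lemma cmap_congr {F : SimplexCat K ⥤ N} (hF : BoundedDiagram F) {x z : SimplexCat K}
    (hx : Nondeg x) (f f' : z ⟶ x) (h : (qF K).map f = (qF K).map f') (hf : ¬ Sur f)
    (hf' : ¬ Sur f') : cmap F f hf = cmap F f' hf' := by
  have h0 := (CategoryTheory.Quotient.functor_homRel_eq_compClosure_eqvGen (rel K) f f').1 h
  have key : (Sur f ↔ Sur f') ∧ ∀ hf hf', cmap F f hf = cmap F f' hf' := by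
    clear hf hf' h
    induction h0 with
    | rel f f' h =>
      obtain ⟨a, b, s, m₁, m₂, t, hr⟩ := h
      by_cases ht : Sur t
      · obtain ⟨y, α, hα, hm⟩ := hr
        obtain ⟨g, rfl⟩ := exists_factor hx t ht α hα
        have : s ≫ m₁ ≫ α ≫ g = s ≫ m₂ ≫ α ≫ g := by
          rw [← Category.assoc m₁, hm, Category.assoc]
        rw [this]
        exact ⟨Iff.rfl, fun _ _ => rfl⟩
      · have h1 : ∀ m : a ⟶ b, ¬ Sur (s ≫ m ≫ t) := fun m h => by
          rw [← Category.assoc] at h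
          exact ht (sur_of_comp _ _ h)
        refine ⟨iff_of_false (h1 _) (h1 _), fun hf hf' => ?_⟩
        have h2 : ∀ (m : a ⟶ b) (hm), cmap F (s ≫ m ≫ t) hm =
            F.map s ≫ F.map m ≫ cmap F t ht := fun m hm => by
          have hmt : ¬ Sur (m ≫ t) := fun h => ht (sur_of_comp _ _ h)
          rw [map_cmap F m t ht hmt, map_cmap F s (m ≫ t) hmt hm]
        rw [h2, h2, bounded_rel hF _ _ _ _ hr]
    | refl f => exact ⟨Iff.rfl, fun _ _ => rfl⟩
    | symm f f' _ ih => exact ⟨ih.1.symm, fun hf hf' => (ih.2 _ _).symm⟩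
    | trans f f' f'' _ _ ih ih' =>
      exact ⟨ih.1.trans ih'.1, fun hf hf'' =>
        (ih.2 hf (fun h => hf (ih.1.2 h))).trans (ih'.2 _ _)⟩
  exact key.2 hf hf'

lemma hasLiftingProperty_of_latchLift {F G : BoundedDiagramCat K N} (φ : F ⟶ G)
    {x : SimplexCat K} (hx : Nondeg x) {X Y : N} (p : X ⟶ Y)
    (h : LatchLift ((toQ K N).map φ) ((qF K).obj x) p) :
    HasLiftingProperty (lc φ.hom x) p := by
  refine ⟨fun {a e} sq => ?_⟩
  let pre : ∀ {z : QCat K} (b : z ⟶ (qF K).obj x), z.as ⟶ x := fun {z} b =>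
    ((qF K).map_surjective (X := z.as) (Y := x) b).choose
  have hpre : ∀ {z : QCat K} (b : z ⟶ (qF K).obj x), (qF K).map (pre b) = b := fun {z} b =>
    ((qF K).map_surjective (X := z.as) (Y := x) b).choose_spec
  have hpre' : ∀ {z : QCat K} (b : z ⟶ (qF K).obj x), ¬ IsSplitEpi b → ¬ Sur (pre b) :=
    fun {z} b hb h => hb (by rw [← hpre b]; exact (isSplitEpi_qF_map_iff hx _).2 h)
  have hc : ∀ {z : SimplexCat K} (f : z ⟶ x) (hf : ¬ Sur f)
      (hb : ¬ IsSplitEpi ((qF K).map f)),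
      cmap G.obj (pre ((qF K).map f)) (hpre' _ hb) = cmap G.obj f hf := fun f hf hb =>
    cmap_congr G.property hx _ _ (hpre _) _ _
  have hns : ∀ {z : SimplexCat K} (f : z ⟶ x), ¬ Sur f → ¬ IsSplitEpi ((qF K).map f) :=
    fun f hf h => hf ((isSplitEpi_qF_map_iff hx _).1 h)
  obtain ⟨(l : G.obj.obj x ⟶ X), h₁, h₂, h₃⟩ := h
    (fun {z} b hb => cmap G.obj (pre b) (hpre' b hb) ≫ pinr φ.hom x ≫ a)
    (by
      rintro ⟨z⟩ ⟨z'⟩ g b hb hgb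
      obtain ⟨g, rfl⟩ := (qF K).map_surjective (X := z') (Y := z) g
      obtain ⟨f, rfl⟩ := (qF K).map_surjective (X := z) (Y := x) b
      have hf : ¬ Sur f := fun h => hb ((isSplitEpi_qF_map_iff hx _).2 h)
      have hgf : ¬ Sur (g ≫ f) := fun h => hf (sur_of_comp _ _ h)
      have e1 := hc f hf hb
      have e2 := hc (g ≫ f) hgf hgb
      have e3 := map_cmap G.obj g f hf hgf
      have e4 : G.obj.map g ≫ (cmap G.obj f hf ≫ pinr φ.hom x ≫ a) =
          cmap G.obj (g ≫ f) hgf ≫ pinr φ.hom x ≫ a := by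
        rw [← e3, Category.assoc]
      rw [← e1, ← e2] at e4
      exact e4)
    (pinl φ.hom x ≫ a) e
    (by
      rintro ⟨z⟩ b hb
      obtain ⟨f, rfl⟩ := (qF K).map_surjective (X := z) (Y := x) b
      have hf : ¬ Sur f := fun h => hb ((isSplitEpi_qF_map_iff hx _).2 h)
      have e1 := hc f hf hb
      have e2 := cmap_vert F.obj f hf
      have e3 := cmap_lmap φ.hom f hf
      have e4 : F.obj.map f ≫ pinl φ.hom x ≫ a =
        φ.hom.app z ≫ cmap G.obj f hf ≫ pinr φ.hom x ≫ a := by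
          rw [← e2, Category.assoc, ← Category.assoc (vert F.obj x), pcond, Category.assoc,
            ← Category.assoc, e3, Category.assoc]
      rw [← e1] at e4
      exact e4)
    (by
      have e1 := pinl φ.hom x ≫= sq.w
      rw [← Category.assoc, ← Category.assoc, pinl_lc] at e1
      exact e1.symm)
    (by
      rintro ⟨z⟩ b hb
      obtain ⟨f, rfl⟩ := (qF K).map_surjective (X := z) (Y := x) b
      have hf : ¬ Sur f := fun h => hb ((isSplitEpi_qF_map_iff hx _).2 h)
      have e1 := hc f hf hb
      have e2 : (cmap G.obj f hf ≫ pinr φ.hom x ≫ a) ≫ p =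
          G.obj.map f ≫ e := by
        rw [Category.assoc, Category.assoc, sq.w, ← Category.assoc (pinr φ.hom x),
          pinr_lc, ← Category.assoc, cmap_vert]
      rw [← e1] at e2
      exact e2)
  have h₁' : φ.hom.app x ≫ l = pinl φ.hom x ≫ a := h₁
  have h₂' : ∀ {z : SimplexCat K} (f : z ⟶ x) (hf : ¬ Sur f),
      G.obj.map f ≫ l = cmap G.obj f hf ≫ pinr φ.hom x ≫ a := fun f hf => by
    have e1 := h₂ _ (hns f hf)
    have e2 := hc _ hf (hns _ hf)
    rw [← e2]
    exact e1
  refine ⟨⟨⟨l, ?_, h₃⟩⟩⟩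
  apply PP_hom_ext
  · rw [← Category.assoc, pinl_lc]
    exact h₁'
  · rw [← Category.assoc, pinr_lc]
    apply cmap_hom_ext
    intro z f hf
    rw [← Category.assoc, cmap_vert]
    exact h₂' f hf

lemma latchLift_of_hasLiftingProperty {F G : BoundedDiagramCat K N} (φ : F ⟶ G)
    {x : SimplexCat K} (hx : Nondeg x) {X Y : N} (p : X ⟶ Y)
    (h : HasLiftingProperty (lc φ.hom x) p) :
    LatchLift ((toQ K N).map φ) ((qF K).obj x) p := by
  intro c hc (a : F.obj.obj x ⟶ X) (e : G.obj.obj x ⟶ Y) h₁ h₂ h₃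
  have hns : ∀ {z : SimplexCat K} (f : z ⟶ x), ¬ Sur f → ¬ IsSplitEpi ((qF K).map f) :=
    fun f hf h => hf ((isSplitEpi_qF_map_iff hx _).1 h)
  let c' : ∀ {z : SimplexCat K} (f : z ⟶ x) (_ : ¬ Sur f), G.obj.obj z ⟶ X :=
    fun {z} f hf => c ((qF K).map f) (hns f hf)
  have h₁' : ∀ {z : SimplexCat K} (f : z ⟶ x) (hf : ¬ Sur f),
      F.obj.map f ≫ a = φ.hom.app z ≫ c' f hf := fun f hf => h₁ _ (hns f hf)
  have h₂' : φ.hom.app x ≫ e = a ≫ p := h₂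
  have h₃' : ∀ {z : SimplexCat K} (f : z ⟶ x) (hf : ¬ Sur f),
      c' f hf ≫ p = G.obj.map f ≫ e := fun f hf => h₃ _ (hns f hf)
  obtain ⟨d, hd⟩ := cmap_desc G.obj c' (fun {z z'} g f hf hgf =>
    hc ((qF K).map g) ((qF K).map f) (hns f hf) (hns _ hgf))
  obtain ⟨a', ha₁, ha₂⟩ := PP_desc φ.hom x a d (by
    apply cmap_hom_ext
    intro z f hf
    rw [← Category.assoc, ← Category.assoc, cmap_vert, cmap_lmap, Category.assoc, hd]
    exact h₁' f hf)
  have sq : CommSq a' (lc φ.hom x) p e := ⟨by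
    apply PP_hom_ext
    · rw [← Category.assoc, ← Category.assoc, pinl_lc, ha₁]
      exact h₂'.symm
    · rw [← Category.assoc, ← Category.assoc, pinr_lc, ha₂]
      apply cmap_hom_ext
      intro z f hf
      rw [← Category.assoc, hd, ← Category.assoc, cmap_vert]
      exact h₃' f hf⟩
  have := h.sq_hasLift sq
  refine ⟨sq.lift, ?_, ?_, sq.fac_right⟩
  · have e1 := pinl φ.hom x ≫= sq.fac_left
    rw [← Category.assoc, pinl_lc, ha₁] at e1
    exact e1
  · rintro ⟨z⟩ b hb
    obtain ⟨f, rfl⟩ := (qF K).map_surjective (X := z) (Y := x) b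
    have hf : ¬ Sur f := fun h => hb ((isSplitEpi_qF_map_iff hx _).2 h)
    have e1 := pinr φ.hom x ≫= sq.fac_left
    rw [← Category.assoc, pinr_lc, ha₂] at e1
    have e2 : G.obj.map f ≫ sq.lift = c' f hf := by
      rw [← hd f hf, ← e1, ← Category.assoc, cmap_vert]
    exact e2

end

end SimplexAux

end Comparison

section Assembly

variable {C : Type u₂} [Category.{v₂} C]

lemma isRetractOfArrow_left {X Y Z : C} {f : X ⟶ Y} {i : X ⟶ Z} {p : Z ⟶ Y} (h : i ≫ p = f)
    (hl : HasLiftingProperty f p) : IsRetractOfArrow f i := by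
  have sq : CommSq i f p (𝟙 Y) := ⟨by rw [h, Category.comp_id]⟩
  have := hl.sq_hasLift sq
  refine ⟨𝟙 X, 𝟙 X, sq.lift, p, Category.comp_id _, sq.fac_right, ?_, ?_⟩
  · rw [Category.id_comp, sq.fac_left]
  · rw [Category.id_comp, h]

lemma isRetractOfArrow_right {X Y Z : C} {f : X ⟶ Y} {i : X ⟶ Z} {p : Z ⟶ Y} (h : i ≫ p = f)
    (hl : HasLiftingProperty i f) : IsRetractOfArrow f p := by
  have sq : CommSq (𝟙 X) i f p := ⟨by rw [h, Category.id_comp]⟩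
  have := hl.sq_hasLift sq
  refine ⟨i, sq.lift, 𝟙 Y, 𝟙 Y, sq.fac_left, Category.comp_id _, ?_, ?_⟩
  · rw [Category.comp_id, h]
  · rw [Category.comp_id, sq.fac_right]

lemma IsRetractOfArrow.hasLiftingProperty {X Y X' Y' A B : C} {f : X ⟶ Y} {g : X' ⟶ Y'}
    (h : IsRetractOfArrow f g) (p : A ⟶ B) (hl : HasLiftingProperty g p) :
    HasLiftingProperty f p := by
  obtain ⟨a, a', b, b', h1, h2, h3, h4⟩ := h
  refine ⟨fun {s t} sq => ?_⟩
  have sq' : CommSq (a' ≫ s) g p (b' ≫ t) :=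
    ⟨by rw [Category.assoc, sq.w, ← Category.assoc, h4, Category.assoc]⟩
  have := hl.sq_hasLift sq'
  refine ⟨⟨⟨b ≫ sq'.lift, ?_, ?_⟩⟩⟩
  · rw [← Category.assoc, ← h3, Category.assoc, sq'.fac_left, ← Category.assoc, h1,
      Category.id_comp]
  · rw [Category.assoc, sq'.fac_right, ← Category.assoc, h2, Category.id_comp]

namespace ModelStructure

variable (ms : ModelStructure C)

/-- Acyclic fibrations. -/
def TF : MorphismProperty C := fun _ _ f => ms.fib f ∧ ms.weq f

/-- Acyclic cofibrations. -/
def TC : MorphismProperty C := fun _ _ f => ms.cof f ∧ ms.weq f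

lemma llp_TF : ms.TF.llp = ms.cof := by
  ext X Y f
  constructor
  · intro hf
    obtain ⟨Z, i, p, hi, hp, hp', h⟩ := ms.factorization_cof_acyclicFib f
    exact ms.cof_retract (isRetractOfArrow_left h (hf p ⟨hp, hp'⟩)) hi
  · intro hf A B p hp
    exact ms.lifting_cof_acyclicFib f p hf hp.1 hp.2

lemma rlp_cof : ms.cof.rlp = ms.TF := by
  ext X Y f
  constructor
  · intro hf
    obtain ⟨Z, i, p, hi, hp, hp', h⟩ := ms.factorization_cof_acyclicFib f
    have := isRetractOfArrow_right h (hf i hi)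
    exact ⟨ms.fib_retract this hp, ms.weq_retract this hp'⟩
  · intro hf A B i hi
    exact ms.lifting_cof_acyclicFib i f hi hf.1 hf.2

lemma llp_fib : ms.fib.llp = ms.TC := by
  ext X Y f
  constructor
  · intro hf
    obtain ⟨Z, i, p, hi, hi', hp, h⟩ := ms.factorization_acyclicCof_fib f
    have := isRetractOfArrow_left h (hf p hp)
    exact ⟨ms.cof_retract this hi, ms.weq_retract this hi'⟩
  · intro hf A B p hp
    exact ms.lifting_acyclicCof_fib f p hf.1 hf.2 hp

lemma rlp_TC : ms.TC.rlp = ms.fib := by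
  ext X Y f
  constructor
  · intro hf
    obtain ⟨Z, i, p, hi, hi', hp, h⟩ := ms.factorization_acyclicCof_fib f
    exact ms.fib_retract (isRetractOfArrow_right h (hf i ⟨hi, hi'⟩)) hp
  · intro hf A B i hi
    exact ms.lifting_acyclicCof_fib i f hi.1 hi.2 hf

lemma TF_respectsIso : ms.TF.RespectsIso := by
  rw [← rlp_cof]; infer_instance

lemma fib_respectsIso : ms.fib.RespectsIso := by
  rw [← rlp_TC]; infer_instance

end ModelStructure

end Assembly

section Main

open SimplexAux

variable {N : Type u} [Category.{v} N] [HasLimits N] [HasColimits N] (ms : ModelStructure N)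
  {K : SSet.{0}}

lemma boundedCof_iff {F G : BoundedDiagramCat K N} (φ : F ⟶ G) :
    boundedCof ms K φ ↔ (ms.TF.functorCategory (QCat K)).llp ((toQ K N).map φ) := by
  constructor
  · intro h X Y p hp
    refine _root_.hasLiftingProperty_of_latchLift (directData K) _ p fun y hy => ?_
    refine SimplexAux.latchLift_of_hasLiftingProperty φ (x := y.as) hy _ ?_
    have h1 : ms.cof (lc φ.hom y.as) := h y.as.unop hy
    exact ms.lifting_cof_acyclicFib _ _ h1 (hp y).1 (hp y).2
  · intro h x hx
    have h1 : ms.TF.llp (lc φ.hom (op x)) := by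
      intro X Y p hp
      refine SimplexAux.hasLiftingProperty_of_latchLift φ (x := op x) hx p ?_
      rw [← ms.rlp_cof] at h hp
      exact latchLift_of_llp _ h _ p hp
    rw [ms.llp_TF] at h1
    exact h1

lemma toQ_hasLiftingProperty_iff {F G F' G' : BoundedDiagramCat K N} (i : F ⟶ G) (p : F' ⟶ G') :
    HasLiftingProperty ((toQ K N).map i) ((toQ K N).map p) ↔ HasLiftingProperty i p := by
  constructor
  · intro h
    refine ⟨fun {a b} sq => ?_⟩
    have sq' := sq.map (toQ K N)
    have := h.sq_hasLift sq'
    refine ⟨⟨⟨(toQ K N).preimage sq'.lift, ?_, ?_⟩⟩⟩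
    · apply (toQ K N).map_injective
      rw [Functor.map_comp, Functor.map_preimage, sq'.fac_left]
    · apply (toQ K N).map_injective
      rw [Functor.map_comp, Functor.map_preimage, sq'.fac_right]
  · intro h
    refine ⟨fun {a b} sq => ?_⟩
    obtain ⟨a, rfl⟩ := (toQ K N).map_surjective a
    obtain ⟨b, rfl⟩ := (toQ K N).map_surjective b
    have sq' : CommSq a i p b := ⟨(toQ K N).map_injective (by
      rw [Functor.map_comp, Functor.map_comp, sq.w])⟩
    have := h.sq_hasLift sq'
    refine ⟨⟨⟨(toQ K N).map sq'.lift, ?_, ?_⟩⟩⟩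
    · rw [← Functor.map_comp, sq'.fac_left]
    · rw [← Functor.map_comp, sq'.fac_right]

lemma bounded_factorization {A B : MorphismProperty N} [B.RespectsIso] (hAB : A ≤ B.llp)
    (hfac : ∀ {X Y : N} (f : X ⟶ Y), ∃ (Z : N) (i : X ⟶ Z) (p : Z ⟶ Y), A i ∧ B p ∧ i ≫ p = f)
    {F G : BoundedDiagramCat K N} (φ : F ⟶ G) :
    ∃ (H : BoundedDiagramCat K N) (j : F ⟶ H) (p : H ⟶ G), j ≫ p = φ ∧
      (B.functorCategory (QCat K)).llp ((toQ K N).map j) ∧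
      ∀ x : SimplexCat K, B (p.hom.app x) := by
  obtain ⟨H, j, p, h, hj, hp⟩ := exists_factorization (directData K) hAB hfac ((toQ K N).map φ)
  let e := (toQ K N).objObjPreimageIso H
  refine ⟨(toQ K N).objPreimage H, (toQ K N).preimage (j ≫ e.inv), (toQ K N).preimage (e.hom ≫ p),
    ?_, ?_, fun x => ?_⟩
  · apply (toQ K N).map_injective
    rw [Functor.map_comp, Functor.map_preimage, Functor.map_preimage, Category.assoc,
      e.inv_hom_id_assoc, h]
  · rw [Functor.map_preimage]
    exact MorphismProperty.RespectsIso.postcomp _ _ _ hj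
  · rw [← toQ_map_app, Functor.map_preimage, NatTrans.comp_app]
    exact MorphismProperty.RespectsIso.precomp _ _ _ (hp _)

lemma isRetractOfArrow_app {F G F' G' : BoundedDiagramCat K N} {f : F ⟶ G} {g : F' ⟶ G'}
    (h : IsRetractOfArrow f g) (x : SimplexCat K) :
    IsRetractOfArrow (f.hom.app x) (g.hom.app x) := by
  obtain ⟨a, a', b, b', h1, h2, h3, h4⟩ := h
  exact ⟨a.hom.app x, a'.hom.app x, b.hom.app x, b'.hom.app x,
    congrArg (fun t => t.hom.app x) h1, congrArg (fun t => t.hom.app x) h2,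
    congrArg (fun t => t.hom.app x) h3, congrArg (fun t => t.hom.app x) h4⟩

lemma bounded_lift {F G F' G' : BoundedDiagramCat K N} (i : F ⟶ G) (p : F' ⟶ G')
    (hi : boundedCof ms K i) (hp : boundedFib ms K p) (hp' : boundedWeq ms K p) :
    HasLiftingProperty i p :=
  (toQ_hasLiftingProperty_iff i p).1
    ((boundedCof_iff ms i).1 hi _ fun z => ⟨hp z.as, hp' z.as⟩)

lemma boundedCof_of_lift {F G : BoundedDiagramCat K N} (i : F ⟶ G)
    (h : ∀ {F' G' : BoundedDiagramCat K N} (p : F' ⟶ G'), boundedFib ms K p → boundedWeq ms K p →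
      HasLiftingProperty i p) : boundedCof ms K i := by
  have hr := ms.TF_respectsIso
  rw [boundedCof_iff]
  intro X Y p hp
  let eX := (toQ K N).objObjPreimageIso X
  let eY := (toQ K N).objObjPreimageIso Y
  let q : (toQ K N).objPreimage X ⟶ (toQ K N).objPreimage Y :=
    (toQ K N).preimage (eX.hom ≫ p ≫ eY.inv)
  have hq : (toQ K N).map q = eX.hom ≫ p ≫ eY.inv := Functor.map_preimage _ _
  have hqq : ∀ x : SimplexCat K, ms.TF (q.hom.app x) := fun x => by
    rw [← toQ_map_app, hq, NatTrans.comp_app, NatTrans.comp_app]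
    exact MorphismProperty.RespectsIso.precomp _ _ _
      (MorphismProperty.RespectsIso.postcomp _ _ _ (hp _))
  have h1 := (toQ_hasLiftingProperty_iff i q).2 (h q (fun x => (hqq x).1) (fun x => (hqq x).2))
  have e : Arrow.mk ((toQ K N).map q) ≅ Arrow.mk p := Arrow.isoMk eX eY (by simp [hq])
  exact (HasLiftingProperty.iff_of_arrow_iso_right _ e).1 h1

lemma bounded_acyclic_factorization {F G : BoundedDiagramCat K N} (φ : F ⟶ G) :
    ∃ (H : BoundedDiagramCat K N) (j : F ⟶ H) (p : H ⟶ G), boundedCof ms K j ∧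
      boundedWeq ms K j ∧ boundedFib ms K p ∧ j ≫ p = φ ∧
      (ms.fib.functorCategory (QCat K)).llp ((toQ K N).map j) := by
  have hr := ms.fib_respectsIso
  obtain ⟨H, j, p, h, hj, hp⟩ := bounded_factorization (A := ms.TC) (B := ms.fib) ms.llp_fib.ge
    (fun f => by
      obtain ⟨Z, i, p, h1, h2, h3, h4⟩ := ms.factorization_acyclicCof_fib f
      exact ⟨Z, i, p, ⟨h1, h2⟩, h3, h4⟩) φ
  refine ⟨H, j, p, ?_, ?_, hp, h, hj⟩
  · rw [boundedCof_iff]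
    intro X Y q hq
    exact hj q fun z => (hq z).1
  · intro x
    have hj' := hj
    rw [← ms.rlp_TC] at hj'
    have := llp_app_of_llp_functorCategory _ hj' ((qF K).obj x)
    rw [ms.rlp_TC, ms.llp_fib] at this
    exact this.2

/-- The model structure. -/
def boundedModelStructure (K : SSet.{0}) : ModelStructure (BoundedDiagramCat K N) where
  weq := boundedWeq ms K
  fib := boundedFib ms K
  cof := boundedCof ms K
  weq_of_isIso f hf x := by
    apply ms.weq_of_isIso
    have : IsIso ((toQ K N).map f) := inferInstance
    exact inferInstanceAs (IsIso (((toQ K N).map f).app ((qF K).obj x)))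
  weq_comp f g hf hg x := ms.weq_comp _ _ (hf x) (hg x)
  weq_of_comp_left f g hf hg x := ms.weq_of_comp_left _ _ (hf x) (hg x)
  weq_of_comp_right f g hf hg x := ms.weq_of_comp_right _ _ (hf x) (hg x)
  weq_retract h hg x := ms.weq_retract (isRetractOfArrow_app h x) (hg x)
  fib_retract h hg x := ms.fib_retract (isRetractOfArrow_app h x) (hg x)
  cof_retract h hg := boundedCof_of_lift ms _ fun p hp hp' =>
    h.hasLiftingProperty p (bounded_lift ms _ p hg hp hp')
  lifting_cof_acyclicFib i p hi hp hp' := bounded_lift ms i p hi hp hp'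
  lifting_acyclicCof_fib i p hi hi' hp := by
    obtain ⟨H, j, q, -, hj, hq, h, hl⟩ := bounded_acyclic_factorization ms i
    have hq' : boundedWeq ms K q := fun x => by
      refine ms.weq_of_comp_left (j.hom.app x) (q.hom.app x) (hj x) ?_
      have := hi' x
      rw [← h] at this
      exact this
    refine (isRetractOfArrow_left h (bounded_lift ms i q hi hq hq')).hasLiftingProperty p ?_
    exact (toQ_hasLiftingProperty_iff j p).1 (hl _ fun z => hp z.as)
  factorization_cof_acyclicFib f := by
    have hr := ms.TF_respectsIso
    obtain ⟨H, j, p, h, hj, hp⟩ := bounded_factorization (A := ms.cof) (B := ms.TF) ms.llp_TF.ge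
      (fun f => by
        obtain ⟨Z, i, p, h1, h2, h3, h4⟩ := ms.factorization_cof_acyclicFib f
        exact ⟨Z, i, p, h1, ⟨h2, h3⟩, h4⟩) f
    exact ⟨H, j, p, (boundedCof_iff ms j).2 hj, fun x => (hp x).1, fun x => (hp x).2, h⟩
  factorization_acyclicCof_fib f := by
    obtain ⟨H, j, p, h1, h2, h3, h4, -⟩ := bounded_acyclic_factorization ms f
    exact ⟨H, j, p, h1, h2, h3, h4⟩

end Main

/-- Let `M` be a model category with all small limits and colimits
and `K` a simplicial set.  The category `Fun^b(𝐊, M)` of bounded diagrams, with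
objectwise weak equivalences, objectwise fibrations, and the cofibrations of
Definition `boundedCof`, satisfies the axioms MC1–MC5 of a model category. -/
theorem boundedDiagrams_modelStructure
    {M : Type u} [Category.{v} M] [HasLimits M] [HasColimits M]
    (ms : ModelStructure M) (K : SSet.{0}) :
    HasLimits (BoundedDiagramCat K M) ∧ HasColimits (BoundedDiagramCat K M) ∧
    ∃ msb : ModelStructure (BoundedDiagramCat K M),
      msb.weq = boundedWeq ms K ∧ msb.fib = boundedFib ms K ∧
        msb.cof = boundedCof ms K := by
  refine ⟨?_, ?_, boundedModelStructure ms K, rfl, rfl, rfl⟩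
  · exact Adjunction.has_limits_of_equivalence (SimplexAux.toQ K M)
  · exact Adjunction.has_colimits_of_equivalence (SimplexAux.toQ K M)
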